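/- arXiv:1509.00370 — 5 statements merged into one kernel-verified Lean document; each statement's English description precedes it below -/
import Mathlib

section
/- Let G be a finite tree in which there exists a path containing all vertices of G of degree 3 or more. Then G is friendly to the simple path, i.e., there exists a bijection (numbering) from the edge set of G to {1,…,|E(G)|} such that for every k and every integer s, the path between the edges numbered k and k+1 contains either both of the edges numbered k+2s and k+2s+1 or neither of them. -/
open SimpleGraph

/-- `G` (a tree) is friendly to the simple path: there is a numbering of its edges
(here `f i` is the edge receiving number `i + 1`) such that for all `k`, `a` of the same
parity (`a = k + 2s`), the path in `G` between the edges numbered `k` and `k + 1` contains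
the edge numbered `a` iff it contains the edge numbered `a + 1`. -/
def FriendlyToPath {V : Type*} [Fintype V] [DecidableEq V] (G : SimpleGraph V)
    [DecidableRel G.Adj] : Prop :=
  ∃ f : Fin G.edgeFinset.card → Sym2 V,
    (∀ i, f i ∈ G.edgeFinset) ∧ Function.Injective f ∧
    ∀ (k a : ℕ) (hk : k + 1 < G.edgeFinset.card) (ha : a + 1 < G.edgeFinset.card),
      a % 2 = k % 2 →
      ∀ (u v : V) (w : G.Walk u v), w.IsPath →
        u ∈ f ⟨k, Nat.lt_of_succ_lt hk⟩ → v ∈ f ⟨k + 1, hk⟩ →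
        f ⟨k, Nat.lt_of_succ_lt hk⟩ ∉ w.edges → f ⟨k + 1, hk⟩ ∉ w.edges →
        (f ⟨a, Nat.lt_of_succ_lt ha⟩ ∈ w.edges ↔ f ⟨a + 1, ha⟩ ∈ w.edges)

section Segments

variable {V : Type*}

/-- The list, cut into consecutive pairs from its head, meets `S` in whole pairs only
(an unpaired last entry has to lie outside `S`). -/
def PairClosed (S : Finset V) : List V → Prop
  | [] => True
  | [x] => x ∉ S
  | x :: y :: l => (x ∈ S ↔ y ∈ S) ∧ PairClosed S l

/-- The nested ordering of a list of legs: all first vertices in order, then the remainders of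
the legs in reverse order. -/
def nestLegs : List (List V) → List V
  | [] => []
  | [] :: xs => nestLegs xs
  | (x :: l) :: xs => x :: (nestLegs xs ++ l)

theorem PairClosed.congr {S T : Finset V} {l : List V} (h : PairClosed S l)
    (hST : ∀ z ∈ l, z ∈ T ↔ z ∈ S) : PairClosed T l := by
  induction l using PairClosed.induct with
  | case1 => trivial
  | case2 x => simp_all [PairClosed]
  | case3 x y l ih => simp_all [PairClosed]

theorem pairClosed_of_disjoint {S : Finset V} {l : List V} (h : ∀ z ∈ l, z ∉ S) :
    PairClosed S l := by
  induction l using PairClosed.induct with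
  | case1 => trivial
  | case2 x => simp_all [PairClosed]
  | case3 x y l ih => simp_all [PairClosed]

theorem pairClosed_of_subset {S : Finset V} {l : List V} (h : ∀ z ∈ l, z ∈ S)
    (hl : Even l.length) : PairClosed S l := by
  induction l using PairClosed.induct with
  | case1 => trivial
  | case2 x => simp at hl
  | case3 x y l ih =>
    simp_all [PairClosed]
    exact ih (by grind)

theorem PairClosed.append {S : Finset V} {l₁ l₂ : List V} (h₁ : PairClosed S l₁)
    (h₂ : PairClosed S l₂) (hl : Even l₁.length) : PairClosed S (l₁ ++ l₂) := by
  induction l₁ using PairClosed.induct with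
  | case1 => exact h₂
  | case2 x => simp at hl
  | case3 x y l ih => exact ⟨h₁.1, ih h₁.2 (by grind)⟩

theorem PairClosed.mem_iff {S : Finset V} {l : List V} (h : PairClosed S l) (j : ℕ)
    (hj : 2 * j + 1 < l.length) : l[2 * j] ∈ S ↔ l[2 * j + 1] ∈ S := by
  induction l using PairClosed.induct generalizing j with
  | case1 => simp at hj
  | case2 x => simp at hj
  | case3 x y l ih =>
    cases j with
    | zero => exact h.1
    | succ j => exact ih h.2 j (by grind)

theorem nestLegs_perm (xs : List (List V)) : (nestLegs xs).Perm xs.flatten := by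
  induction xs using nestLegs.induct with
  | case1 => simp [nestLegs]
  | case2 xs ih => simpa [nestLegs] using ih
  | case3 x l xs ih =>
    simp only [nestLegs, List.flatten_cons, List.cons_append]
    exact (List.perm_append_comm.trans (ih.append_left l)).cons x

theorem even_length_nestLegs {xs : List (List V)} (h : ∀ l ∈ xs, Even l.length) :
    Even (nestLegs xs).length := by
  induction xs using nestLegs.induct with
  | case1 => simp [nestLegs]
  | case2 xs ih => exact ih (by grind)
  | case3 x l xs ih =>
    have := ih (by grind)
    have := h (x :: l) (by simp)
    simp only [nestLegs]
    grind

variable [DecidableEq V]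

/-- `A x` stands for the set of ancestors of `x`. Reading the list `p.reverse ++ s`, the set
`A x ∆ A y` is made of whole pairs on both sides of `x, y`, for all consecutive `x, y` in `s`. -/
def FriendlyFrom (A : V → Finset V) : List V → List V → Prop
  | p, x :: y :: s => PairClosed (symmDiff (A x) (A y)) p ∧
      PairClosed (symmDiff (A x) (A y)) s ∧ FriendlyFrom A (x :: p) (y :: s)
  | _, _ => True

/-- `l` is a descending chain of vertices hanging below the ancestor set `B`. -/
def IsLeg (A : V → Finset V) : Finset V → List V → Prop
  | _, [] => True
  | B, x :: l => x ∉ B ∧ A x = insert x B ∧ IsLeg A (insert x B) l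

/-- Entering the list `s` from a place with ancestor set `B` crosses whole pairs of `s.tail`. -/
def StartsAt (A : V → Finset V) (B : Finset V) : List V → Prop
  | [] => True
  | h :: s => B ⊆ A h ∧ (∀ z ∈ A h, z ∉ B → z ∈ h :: s) ∧ PairClosed (A h \ B) s

/-- A list of vertices below `B` that can be appended to any admissible list. -/
structure Segment (A : V → Finset V) (B : Finset V) (s : List V) : Prop where
  nodup : s.Nodup
  startsAt : StartsAt A B s
  friendly : ∀ p : List V, p.Disjoint s → FriendlyFrom A p s

theorem FriendlyFrom.pairClosed {A : V → Finset V} {p s : List V} (h : FriendlyFrom A p s)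
    (k : ℕ) (hk : k + 1 < s.length) :
    PairClosed (symmDiff (A s[k]) (A s[k + 1])) ((s.take k).reverse ++ p) ∧
      PairClosed (symmDiff (A s[k]) (A s[k + 1])) (s.drop (k + 2)) := by
  induction k generalizing p s with
  | zero =>
    match s, h with
    | x :: y :: s, h => exact ⟨h.1, h.2.1⟩
  | succ k ih =>
    match s, h with
    | x :: y :: s, h =>
      have := ih h.2.2 (by grind)
      simpa using this

theorem FriendlyFrom.mem_iff {A : V → Finset V} {l : List V} (h : FriendlyFrom A [] l)
    {k a : ℕ} (hk : k + 1 < l.length) (ha : a + 1 < l.length) (hpar : a % 2 = k % 2)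
    (hne : a ≠ k) :
    l[a] ∈ symmDiff (A l[k]) (A l[k + 1]) ↔ l[a + 1] ∈ symmDiff (A l[k]) (A l[k + 1]) := by
  obtain ⟨h₁, h₂⟩ := h.pairClosed k hk
  rw [List.append_nil] at h₁
  rcases lt_or_gt_of_ne hne with hlt | hgt
  · obtain ⟨j, rfl⟩ : ∃ j, k = a + 2 + 2 * j := ⟨(k - a - 2) / 2, by omega⟩
    have key := h₁.mem_iff j (by simp; omega)
    have e₁ : (l.take (a + 2 + 2 * j)).reverse[2 * j]'(by simp; omega) = l[a + 1] := by
      simp only [List.getElem_reverse, List.getElem_take, List.length_take]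
      congr 1
      omega
    have e₂ : (l.take (a + 2 + 2 * j)).reverse[2 * j + 1]'(by simp; omega) = l[a] := by
      simp only [List.getElem_reverse, List.getElem_take, List.length_take]
      congr 1
      omega
    rw [e₁, e₂] at key
    exact key.symm
  · obtain ⟨j, rfl⟩ : ∃ j, a = k + 2 + 2 * j := ⟨(a - k - 2) / 2, by omega⟩
    have key := h₂.mem_iff j (by simp; omega)
    simp only [List.getElem_drop] at key
    exact key

theorem IsLeg.notMem {A : V → Finset V} {B : Finset V} {l : List V} (h : IsLeg A B l) :
    ∀ z ∈ l, z ∉ B := by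
  induction l generalizing B with
  | nil => simp
  | cons x l ih =>
    have := ih h.2.2
    have := h.1
    grind

theorem IsLeg.nodup {A : V → Finset V} {B : Finset V} {l : List V} (h : IsLeg A B l) :
    l.Nodup := by
  induction l generalizing B with
  | nil => simp
  | cons x l ih =>
    have := h.2.2.notMem
    have := ih h.2.2
    grind

theorem IsLeg.isChain {A : V → Finset V} {B : Finset V} {l : List V} (h : IsLeg A B l) :
    l.IsChain (fun x y => symmDiff (A x) (A y) ⊆ {x, y}) := by
  induction l generalizing B with
  | nil => simp
  | cons x l ih =>
    match l, h with
    | [], _ => simp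
    | y :: l, h =>
      refine List.isChain_cons_cons.2 ⟨?_, ih h.2.2⟩
      rw [h.2.1, h.2.2.2.1]
      intro z
      simp only [Finset.mem_symmDiff]
      grind

theorem IsLeg.mem_last_iff {A : V → Finset V} {B : Finset V} {l : List V} {x : V}
    (h : IsLeg A B (l ++ [x])) (z : V) : z ∈ A x ↔ z ∈ B ∨ z ∈ l ++ [x] := by
  induction l generalizing B with
  | nil => rw [h.2.1]; grind
  | cons y l ih => rw [ih h.2.2]; grind

theorem FriendlyFrom.append_of_isChain {A : V → Finset V} {p l s : List V} {x : V}
    (hl : (l ++ [x]).IsChain (fun x y => symmDiff (A x) (A y) ⊆ {x, y}))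
    (hd : p.Disjoint (l ++ x :: s)) (hn : (l ++ x :: s).Nodup)
    (h : FriendlyFrom A (l.reverse ++ p) (x :: s)) : FriendlyFrom A p (l ++ x :: s) := by
  induction l generalizing p with
  | nil => simpa using h
  | cons y l ih =>
    have hd' : (y :: p).Disjoint (l ++ x :: s) := by
      intro z hz
      have := @hd z
      grind
    have key := ih (p := y :: p) hl.tail hd' (List.nodup_cons.1 hn).2
      (by simpa using h)
    obtain ⟨w, q, hq⟩ : ∃ w q, l ++ x :: s = w :: q := by
      cases l <;> simp
    have hw : symmDiff (A y) (A w) ⊆ {y, w} := by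
      cases l <;> grind
    rw [List.cons_append, hq] at hn hd ⊢
    rw [hq] at key
    refine ⟨pairClosed_of_disjoint fun z hz hz' => ?_,
      pairClosed_of_disjoint fun z hz hz' => ?_, key⟩
    · have := hw hz'
      have := hd hz
      grind
    · have := hw hz'
      grind

theorem Segment.nil (A : V → Finset V) (B : Finset V) : Segment A B [] :=
  ⟨List.nodup_nil, trivial, fun _ _ => trivial⟩

theorem Segment.reverse_append {A : V → Finset V} {B : Finset V} {s l : List V}
    (hs : Segment A B s) (hl : IsLeg A B l) (hodd : Odd l.length) (hd : l.Disjoint s) :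
    Segment A B (l.reverse ++ s) := by
  have hln := hl.nodup
  have hsn := hs.nodup
  have hB := hl.notMem
  have hnodup : (l.reverse ++ s).Nodup := by
    refine List.Nodup.append (by simpa using hln) hsn ?_
    intro z hz
    exact hd (by simpa using hz)
  refine ⟨hnodup, ?_, fun p hp => ?_⟩
  · obtain ⟨m, x, rfl⟩ : ∃ m x, l = m ++ [x] := by
      rcases List.eq_nil_or_concat l with rfl | ⟨m, x, rfl⟩
      · simp at hodd
      · exact ⟨m, x, by simp⟩
    have hx := hl.mem_last_iff
    rw [List.reverse_append, List.reverse_singleton, List.singleton_append, List.cons_append]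
    refine ⟨fun z hz => (hx z).2 (.inl hz), fun z hz hz' => ?_, ?_⟩
    · have := hx z
      grind
    · refine PairClosed.append (pairClosed_of_subset ?_ ?_) (pairClosed_of_disjoint ?_) ?_
      · intro z hz
        have := hx z
        grind
      · grind
      · intro z hz
        have := hx z
        have := @hd z
        grind
      · grind
  · match l, hl, hodd with
    | x :: l, hl, hodd =>
      have hx := hl.2.1
      rw [List.reverse_cons, List.append_assoc, List.singleton_append] at hp hnodup ⊢
      refine FriendlyFrom.append_of_isChain ?_ hp hnodup ?_
      · have := hl.isChain
        rw [← List.reverse_cons, List.isChain_reverse]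
        refine this.imp fun a b hab => ?_
        rw [symmDiff_comm, Finset.pair_comm]
        exact hab
      · rw [List.reverse_reverse]
        match s, hs, hd with
        | [], _, _ => trivial
        | h :: s, hs, hd =>
          obtain ⟨h₁, h₂, h₃⟩ := hs.startsAt
          refine ⟨pairClosed_of_disjoint fun z hz hz' => ?_, h₃.congr fun z hz => ?_,
            hs.friendly _ ?_⟩
          · have := h₂ z
            have := @hd z
            have := @hp z
            have := @h₁ z
            rw [hx, Finset.mem_symmDiff] at hz'
            grind
          · have := @hd z
            have := @h₁ z
            rw [hx, Finset.mem_symmDiff]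
            grind
          · intro z hz
            have := @hd z
            have := @hp z
            grind

theorem FriendlyFrom.cons_nestLegs {A : V → Finset V} {B : Finset V} {s p : List V} {u : V}
    {xs : List (List V)} (hu : A u = insert u B) (huB : u ∉ B) (hleg : ∀ l ∈ xs, IsLeg A B l)
    (heven : ∀ l ∈ xs, Even l.length) (hs : StartsAt A (insert u B) s)
    (hn : (u :: (nestLegs xs ++ s)).Nodup) (hd : p.Disjoint (u :: (nestLegs xs ++ s)))
    (h : FriendlyFrom A ((nestLegs xs).reverse ++ u :: p) s) :
    FriendlyFrom A p (u :: (nestLegs xs ++ s)) := by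
  induction xs using nestLegs.induct generalizing u p s with
  | case1 =>
    match s, hs, h with
    | [], _, _ => trivial
    | v :: s, ⟨h₁, h₂, h₃⟩, h =>
      simp only [nestLegs, List.nil_append] at hn hd ⊢
      refine ⟨pairClosed_of_disjoint fun z hz hz' => ?_, h₃.congr fun z hz => ?_, h⟩
      · have := h₂ z
        have := @hd z
        have := @h₁ z
        rw [hu, Finset.mem_symmDiff] at hz'
        grind
      · have := @h₁ z
        rw [hu, Finset.mem_symmDiff]
        grind
  | case2 xs ih => exact ih hu huB (by grind) (by grind) hs hn hd h
  | case3 x l xs ih =>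
    have hx := hleg (x :: l) (by simp)
    have hxe := heven (x :: l) (by simp)
    obtain ⟨hxB, hxA, hlx⟩ := hx
    have hl₀ : l ≠ [] := by rintro rfl; simp at hxe
    simp only [nestLegs, List.cons_append, List.append_assoc] at hn hd ⊢
    have hstep : ∀ z, z ∈ symmDiff (A u) (A x) → z = u ∨ z = x := by
      intro z
      rw [hu, hxA, Finset.mem_symmDiff]
      grind
    refine ⟨pairClosed_of_disjoint fun z hz hz' => ?_,
      pairClosed_of_disjoint fun z hz hz' => ?_, ?_⟩
    · have := hstep z hz'
      have := @hd z
      grind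
    · have := hstep z hz'
      grind
    refine ih hxA hxB (by grind) (by grind) ?_ (by grind) ?_ ?_
    · match l, hlx with
      | y :: l, ⟨hy₁, hy₂, hy₃⟩ =>
        rw [List.cons_append]
        refine ⟨by grind, by grind, pairClosed_of_disjoint ?_⟩
        rw [hy₂]
        intro z hz hz'
        have : z = y := by grind
        grind
    · intro z hz
      have := @hd z
      grind
    obtain ⟨m, y, rfl⟩ : ∃ m y, l = m ++ [y] := by
      rcases List.eq_nil_or_concat l with rfl | ⟨m, x, rfl⟩
      · exact absurd rfl hl₀
      · exact ⟨m, x, by simp⟩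
    have hy := hlx.mem_last_iff
    have hyB := hlx.notMem
    have hxsB : ∀ z ∈ nestLegs xs, z ∉ B := by
      intro z hz
      obtain ⟨q, hq, hzq⟩ := List.mem_flatten.1 ((nestLegs_perm xs).mem_iff.1 hz)
      exact (hleg q (by simp [hq])).notMem z hzq
    have hxse : Even (nestLegs xs).length := even_length_nestLegs (by grind)
    rw [List.append_assoc, List.singleton_append]
    refine FriendlyFrom.append_of_isChain hlx.isChain ?_ (by grind) ?_
    · intro z hz
      have := @hd z
      grind
    match s, hs, h with
    | [], _, _ => trivial
    | v :: s, ⟨h₁, h₂, h₃⟩, h =>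
      have hmem : ∀ z, z ∈ symmDiff (A y) (A v) ↔
          (z ∈ A y ∧ z ∉ A v ∨ z ∈ A v ∧ z ∉ A y) := fun z => Finset.mem_symmDiff
      refine ⟨PairClosed.append (pairClosed_of_subset ?_ ?_)
        (PairClosed.append (pairClosed_of_disjoint ?_) ⟨?_, pairClosed_of_disjoint ?_⟩ ?_) ?_,
        h₃.congr ?_, ?_⟩
      · intro z hz
        have := hy z
        have := h₂ z
        grind
      · grind
      · intro z hz
        have := hy z
        have := h₂ z
        grind
      · have := hy x
        have := h₂ x
        have := hy u
        have := @h₁ u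
        grind
      · intro z hz
        have := hy z
        have := h₂ z
        have := @h₁ z
        have := @hd z
        grind
      · simpa using hxse
      · grind
      · intro z hz
        have := hy z
        have := @h₁ z
        grind
      · simpa [nestLegs] using h

theorem Segment.cons_nestLegs {A : V → Finset V} {B : Finset V} {s : List V} {u : V}
    {xs : List (List V)} (hs : Segment A (insert u B) s) (hu : A u = insert u B) (huB : u ∉ B)
    (hleg : ∀ l ∈ xs, IsLeg A B l) (heven : ∀ l ∈ xs, Even l.length)
    (hn : (u :: (nestLegs xs ++ s)).Nodup) : Segment A B (u :: (nestLegs xs ++ s)) := by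
  refine ⟨hn, ⟨by grind, by grind, pairClosed_of_disjoint fun z hz hz' => ?_⟩, fun p hp =>
    FriendlyFrom.cons_nestLegs hu huB hleg heven hs.startsAt hn hp (hs.friendly _ ?_)⟩
  · have : z = u := by grind
    grind
  · intro z hz
    have := @hp z
    grind

theorem Segment.flatten_reverse_append {A : V → Finset V} {B : Finset V} {s : List V}
    {xs : List (List V)} (hs : Segment A B s) (hleg : ∀ l ∈ xs, IsLeg A B l)
    (hodd : ∀ l ∈ xs, Odd l.length) (hn : (xs.flatten ++ s).Nodup) :
    Segment A B ((xs.map List.reverse).flatten ++ s) := by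
  induction xs with
  | nil => simpa using hs
  | cons l xs ih =>
    rw [List.flatten_cons, List.append_assoc] at hn
    have := ih (by grind) (by grind) (by grind)
    rw [List.map_cons, List.flatten_cons, List.append_assoc]
    refine this.reverse_append (hleg l (by simp)) (hodd l (by simp)) ?_
    intro z hz hz'
    refine (List.nodup_append.1 hn).2.2 z hz z ?_ rfl
    rw [List.mem_append, List.mem_flatten] at hz' ⊢
    simp only [List.mem_map] at hz'
    grind

end Segments

section Rooted

variable {V : Type*} [DecidableEq V]

/-- A tree rooted at `r`, given by the parent function and the ancestor sets (each vertex being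
an ancestor of itself). -/
structure IsRooted (r : V) (par : V → V) (A : V → Finset V) : Prop where
  root : A r = {r}
  notMem_parent : ∀ x, x ≠ r → x ∉ A (par x)
  eq_insert : ∀ x, x ≠ r → A x = insert x (A (par x))

namespace IsRooted

variable {r : V} {par : V → V} {A : V → Finset V}

theorem induction (h : IsRooted r par A) {P : V → Prop} (root : P r)
    (step : ∀ x, x ≠ r → P (par x) → P x) (x : V) : P x := by
  induction hn : (A x).card using Nat.strong_induction_on generalizing x with
  | _ n ih =>
    by_cases hx : x = r
    · exact hx ▸ root
    · refine step x hx (ih _ ?_ _ rfl)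
      rw [← hn, h.eq_insert x hx, Finset.card_insert_of_notMem (h.notMem_parent x hx)]
      exact Nat.lt_succ_self _

theorem self_mem (h : IsRooted r par A) (x : V) : x ∈ A x := by
  by_cases hx : x = r
  · simp [hx, h.root]
  · simp [h.eq_insert x hx]

theorem root_mem (h : IsRooted r par A) (x : V) : r ∈ A x := by
  induction x using h.induction with
  | root => exact h.self_mem r
  | step x hx ih => rw [h.eq_insert x hx]; exact Finset.mem_insert_of_mem ih

theorem mem_iff (h : IsRooted r par A) {x : V} (hx : x ≠ r) (z : V) :
    z ∈ A x ↔ z = x ∨ z ∈ A (par x) := by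
  rw [h.eq_insert x hx, Finset.mem_insert]

theorem trans (h : IsRooted r par A) {x y z : V} (hx : x ∈ A y) (hy : y ∈ A z) : x ∈ A z := by
  induction z using h.induction with
  | root => rw [h.root, Finset.mem_singleton] at hy; exact hy ▸ hx
  | step z hz ih =>
    rw [h.mem_iff hz] at hy
    rcases hy with rfl | hy
    · exact hx
    · exact (h.mem_iff hz _).2 (.inr (ih hy))

theorem antisymm (h : IsRooted r par A) {x y : V} (hx : x ∈ A y) (hy : y ∈ A x) : x = y := by
  by_contra hne
  by_cases hyr : y = r
  · subst hyr
    rw [h.root, Finset.mem_singleton] at hx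
    exact hne hx
  · exact h.notMem_parent y hyr (h.trans hy (((h.mem_iff hyr x).1 hx).resolve_left hne))

theorem exists_child (h : IsRooted r par A) {c d : V} (hc : c ∈ A d) (hne : d ≠ c) :
    ∃ c', c' ≠ r ∧ par c' = c ∧ c' ∈ A d := by
  induction d using h.induction with
  | root => rw [h.root, Finset.mem_singleton] at hc; exact absurd hc.symm hne
  | step d hd ih =>
    by_cases hp : par d = c
    · exact ⟨d, hd, hp, h.self_mem d⟩
    · obtain ⟨c', h₁, h₂, h₃⟩ := ih (((h.mem_iff hd c).1 hc).resolve_left hne.symm) hp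
      exact ⟨c', h₁, h₂, (h.mem_iff hd _).2 (.inr h₃)⟩

theorem eq_of_parent_eq (h : IsRooted r par A) {c c' d : V} (hc : c ≠ r) (hc' : c' ≠ r)
    (hp : par c = par c') (hcd : c ∈ A d) (hcd' : c' ∈ A d) : c = c' := by
  induction d using h.induction with
  | root => rw [h.root, Finset.mem_singleton] at hcd; exact absurd hcd hc
  | step d hd ih =>
    rcases (h.mem_iff hd c).1 hcd with rfl | h₁ <;> rcases (h.mem_iff hd c').1 hcd' with rfl | h₂
    · rfl
    · exact absurd (hp ▸ h₂) (h.notMem_parent c' hc')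
    · exact absurd (hp ▸ h₁) (h.notMem_parent c hc)
    · exact ih h₁ h₂

theorem card_lt [Fintype V] (h : IsRooted r par A) {c : V} (hc : c ≠ r) :
    Fintype.card V - (A c).card < Fintype.card V - (A (par c)).card := by
  have h₁ : (A c).card = (A (par c)).card + 1 := by
    rw [h.eq_insert c hc, Finset.card_insert_of_notMem (h.notMem_parent c hc)]
  have h₂ := (A c).card_le_univ
  omega

theorem exists_isLeg [Fintype V] (h : IsRooted r par A) {c : V} (hc : c ≠ r)
    (hbr : ∀ x y, x ≠ r → y ≠ r → par x = par y → c ∈ A (par x) → x = y) :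
    ∃ l, IsLeg A (A (par c)) l ∧ ∀ d, d ∈ l ↔ c ∈ A d := by
  induction hn : Fintype.card V - (A c).card using Nat.strong_induction_on generalizing c with
  | _ n ih =>
    by_cases hch : ∃ c', c' ≠ r ∧ par c' = c
    · obtain ⟨c', hc', rfl⟩ := hch
      obtain ⟨l, hl, hmem⟩ := ih _ (hn ▸ h.card_lt hc') hc' (fun x y hx hy hp hcx =>
        hbr x y hx hy hp (h.trans ((h.mem_iff hc' _).2 (.inr (h.self_mem _))) hcx)) rfl
      refine ⟨par c' :: l, ⟨h.notMem_parent _ hc, h.eq_insert _ hc, h.eq_insert _ hc ▸ hl⟩, ?_⟩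
      intro d
      rw [List.mem_cons, hmem]
      constructor
      · rintro (rfl | hd)
        · exact h.self_mem _
        · exact h.trans ((h.mem_iff hc' _).2 (.inr (h.self_mem _))) hd
      · intro hd
        by_cases hne : d = par c'
        · exact .inl hne
        · obtain ⟨x, hx, hxp, hxd⟩ := h.exists_child hd hne
          have : x = c' := hbr x c' hx hc' hxp (hxp ▸ h.self_mem _)
          exact .inr (this ▸ hxd)
    · refine ⟨[c], ⟨h.notMem_parent _ hc, h.eq_insert _ hc, trivial⟩, fun d => ?_⟩
      rw [List.mem_singleton]
      refine ⟨fun hd => hd ▸ h.self_mem c, fun hd => ?_⟩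
      by_contra hne
      obtain ⟨x, hx, hxp, -⟩ := h.exists_child hd hne
      exact hch ⟨x, hx, hxp⟩

theorem exists_segment [Fintype V] (h : IsRooted r par A) {t : V}
    (hbr : ∀ x y, x ≠ r → y ≠ r → par x = par y → x ≠ y → par x ∈ A t) (v : V) :
    ∃ s, Segment A (A v) s ∧ ∀ d, d ∈ s ↔ d ≠ v ∧ v ∈ A d := by
  induction hn : Fintype.card V - (A v).card using Nat.strong_induction_on generalizing v with
  | _ n ih =>
    by_cases hch : ∃ c, c ≠ r ∧ par c = v
    swap
    · refine ⟨[], Segment.nil _ _, fun d => ?_⟩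
      simp only [List.not_mem_nil, false_iff, not_and]
      intro hd hvd
      obtain ⟨x, hx, hxp, -⟩ := h.exists_child hvd hd
      exact hch ⟨x, hx, hxp⟩
    obtain ⟨c, hc, hcv, hct⟩ : ∃ c, c ≠ r ∧ par c = v ∧
        ∀ c', c' ≠ r → par c' = v → c' ≠ c → c' ∉ A t := by
      by_cases hex : ∃ c, c ≠ r ∧ par c = v ∧ c ∈ A t
      · obtain ⟨c, hc, hcv, hct⟩ := hex
        exact ⟨c, hc, hcv, fun c' hc' hcv' hne hct' =>
          hne (h.eq_of_parent_eq hc' hc (hcv'.trans hcv.symm) hct' hct)⟩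
      · obtain ⟨c, hc, hcv⟩ := hch
        exact ⟨c, hc, hcv, fun c' hc' hcv' _ hct' => hex ⟨c', hc', hcv', hct'⟩⟩
    subst hcv
    obtain ⟨s, hs, hmem⟩ := ih _ (hn ▸ h.card_lt hc) c rfl
    have hleg : ∀ c', c' ≠ r → par c' = par c → c' ≠ c →
        ∃ l, IsLeg A (A (par c)) l ∧ ∀ d, d ∈ l ↔ c' ∈ A d := by
      intro c' hc' hp hne
      rw [← hp]
      refine h.exists_isLeg hc' fun x y hx hy hxy hcx => ?_
      by_contra hxy'
      exact hct c' hc' hp hne (h.trans hcx (hbr x y hx hy hxy hxy'))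
    choose! leg hleg hlegmem using hleg
    let C : Finset V := Finset.univ.filter fun c' => c' ≠ r ∧ par c' = par c ∧ c' ≠ c
    have hC : ∀ c', c' ∈ C ↔ c' ≠ r ∧ par c' = par c ∧ c' ≠ c := by simp [C]
    let ev : List V := (C.filter fun c' => Even (leg c').length).toList
    let od : List V := (C.filter fun c' => Odd (leg c').length).toList
    have hev : ∀ c', c' ∈ ev ↔ c' ∈ C ∧ Even (leg c').length := by simp [ev]
    have hod : ∀ c', c' ∈ od ↔ c' ∈ C ∧ Odd (leg c').length := by simp [od]
    have hlegC : ∀ c' ∈ C, ∀ d, d ∈ leg c' ↔ c' ∈ A d := fun c' hc' =>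
      hlegmem c' ((hC c').1 hc').1 ((hC c').1 hc').2.1 ((hC c').1 hc').2.2
    have hisLeg : ∀ c' ∈ C, IsLeg A (A (par c)) (leg c') := fun c' hc' =>
      hleg c' ((hC c').1 hc').1 ((hC c').1 hc').2.1 ((hC c').1 hc').2.2
    have hdisj : ∀ c₁ ∈ C, ∀ c₂ ∈ C, c₁ ≠ c₂ → (leg c₁).Disjoint (leg c₂) := by
      intro c₁ h₁ c₂ h₂ hne d hd₁ hd₂
      rw [hlegC _ h₁] at hd₁
      rw [hlegC _ h₂] at hd₂
      rw [hC] at h₁ h₂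
      exact hne (h.eq_of_parent_eq h₁.1 h₂.1 (h₁.2.1.trans h₂.2.1.symm) hd₁ hd₂)
    have hdisjc : ∀ c' ∈ C, ∀ d ∈ leg c', c ∉ A d := by
      intro c' h' d hd hcd
      rw [hlegC _ h'] at hd
      rw [hC] at h'
      exact h'.2.2 (h.eq_of_parent_eq h'.1 hc h'.2.1 hd hcd)
    have hflat : ∀ cs : List V, cs.Nodup → (∀ c' ∈ cs, c' ∈ C) →
        (cs.map leg).flatten.Nodup := by
      intro cs hcs hsub
      rw [List.nodup_flatten]
      refine ⟨by simpa using fun c' hc' => (hisLeg c' (hsub c' hc')).nodup, ?_⟩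
      rw [List.pairwise_map]
      exact hcs.imp_of_mem fun h₁ h₂ hne => hdisj _ (hsub _ h₁) _ (hsub _ h₂) hne
    have hflatmem : ∀ cs : List V, ∀ d, d ∈ (cs.map leg).flatten ↔ ∃ c' ∈ cs, d ∈ leg c' := by
      simp
    have hnest : ∀ d, d ∈ nestLegs (ev.map leg) ↔ ∃ c' ∈ ev, d ∈ leg c' := by
      intro d
      rw [(nestLegs_perm _).mem_iff, hflatmem]
    have hn₁ : (c :: (nestLegs (ev.map leg) ++ s)).Nodup := by
      rw [List.nodup_cons, List.nodup_append, List.mem_append, hnest, hmem]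
      refine ⟨?_, ?_, hs.nodup, ?_⟩
      · rintro (⟨c', hc', hd⟩ | hcs)
        · exact hdisjc c' ((hev c').1 hc').1 c hd (h.self_mem c)
        · exact hcs.1 rfl
      · rw [(nestLegs_perm _).nodup_iff]
        exact hflat _ (Finset.nodup_toList _) fun c' hc' => ((hev c').1 hc').1
      · rintro a ha b hb rfl
        obtain ⟨c', hc', hd⟩ := (hnest a).1 ha
        exact hdisjc c' ((hev c').1 hc').1 a hd ((hmem a).1 hb).2
    have hs₁ : Segment A (A (par c)) (c :: (nestLegs (ev.map leg) ++ s)) := by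
      refine Segment.cons_nestLegs (h.eq_insert c hc ▸ hs) (h.eq_insert c hc)
        (h.notMem_parent c hc) ?_ ?_ hn₁
      · simpa using fun c' hc' => hisLeg c' ((hev c').1 hc').1
      · simpa using fun c' hc' => ((hev c').1 hc').2
    refine ⟨((od.map leg).map List.reverse).flatten ++ (c :: (nestLegs (ev.map leg) ++ s)),
      hs₁.flatten_reverse_append ?_ ?_ ?_, fun d => ?_⟩
    · simpa using fun c' hc' => hisLeg c' ((hod c').1 hc').1
    · simpa using fun c' hc' => ((hod c').1 hc').2
    · refine List.nodup_append.2 ⟨hflat _ (Finset.nodup_toList _) fun c' hc' =>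
        ((hod c').1 hc').1, hn₁, ?_⟩
      rintro a ha b hb rfl
      obtain ⟨c', hc', hd⟩ := (hflatmem _ a).1 ha
      rw [hod] at hc'
      rw [List.mem_cons, List.mem_append, hnest, hmem] at hb
      rcases hb with rfl | ⟨c'', hc'', hd''⟩ | hb
      · exact hdisjc c' hc'.1 a hd (h.self_mem a)
      · rw [hev] at hc''
        refine hdisj c' hc'.1 c'' hc''.1 ?_ hd hd''
        rintro rfl
        exact (Nat.not_even_iff_odd.2 hc'.2) hc''.2
      · exact hdisjc c' hc'.1 a hd hb.2
    · have hrev : d ∈ ((od.map leg).map List.reverse).flatten ↔ ∃ c' ∈ od, d ∈ leg c' := by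
        simp
      rw [List.mem_append, List.mem_cons, List.mem_append, hrev, hnest, hmem]
      have hsub : ∀ c', c' ≠ r → par c' = par c → c' ∈ A d → d ≠ par c ∧ par c ∈ A d := by
        intro c' hc' hp hd
        refine ⟨?_, h.trans ((h.mem_iff hc' _).2 (.inr (hp ▸ h.self_mem _))) hd⟩
        rintro rfl
        exact h.notMem_parent c' hc' (hp ▸ hd)
      constructor
      · rintro (⟨c', hc', hd⟩ | rfl | ⟨c', hc', hd⟩ | hd)
        · rw [hod] at hc'
          have := (hC c').1 hc'.1
          exact hsub c' this.1 this.2.1 ((hlegC c' hc'.1 d).1 hd)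
        · exact hsub d hc rfl (h.self_mem d)
        · rw [hev] at hc'
          have := (hC c').1 hc'.1
          exact hsub c' this.1 this.2.1 ((hlegC c' hc'.1 d).1 hd)
        · exact hsub c hc rfl hd.2
      · rintro ⟨hne, hd⟩
        obtain ⟨c', hc', hp, hcd⟩ := h.exists_child hd hne
        by_cases hcc : c' = c
        · subst hcc
          by_cases hdc : d = c'
          · exact .inr (.inl hdc)
          · exact .inr (.inr (.inr ⟨hdc, hcd⟩))
        · have hC' := (hC c').2 ⟨hc', hp, hcc⟩
          rcases Nat.even_or_odd (leg c').length with he | ho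
          · exact .inr (.inr (.inl ⟨c', (hev c').2 ⟨hC', he⟩, (hlegC c' hC' d).2 hcd⟩))
          · exact .inl ⟨c', (hod c').2 ⟨hC', ho⟩, (hlegC c' hC' d).2 hcd⟩

end IsRooted

end Rooted

section Tree

variable {V : Type*} [DecidableEq V] {G : SimpleGraph V}

theorem exists_isRooted (hT : G.IsTree) (r : V) :
    ∃ (par : V → V) (A : V → Finset V), IsRooted r par A ∧
      (∀ x, x ≠ r → G.Adj x (par x)) ∧
      (∀ a b, G.Adj a b → (b ≠ r ∧ par b = a) ∨ (a ≠ r ∧ par a = b)) ∧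
      ∀ x (p : G.Walk r x), p.IsPath → A x = p.support.toFinset := by
  choose P hP hPu using hT.existsUnique_path r
  let A : V → Finset V := fun x => (P x).support.toFinset
  have hA : ∀ x z, z ∈ A x ↔ z ∈ (P x).support := fun x z => List.mem_toFinset
  have hins : ∀ a b, G.Adj a b → b ∉ A a → A b = insert b (A a) := by
    intro a b hab hb
    rw [hA] at hb
    have hp := hPu b _ ((hP a).concat hb hab)
    ext z
    rw [hA, ← hp, Walk.support_concat, Finset.mem_insert, hA]
    simp
    tauto
  have hasymm : ∀ a b, a ≠ b → a ∈ A b → b ∉ A a := by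
    intro a b hne ha hb
    rw [hA] at ha hb
    have h₁ := (P b).length_takeUntil_lt_length ha hne
    have h₂ := (P a).length_takeUntil_lt_length hb hne.symm
    rw [hPu a _ ((hP b).takeUntil ha)] at h₁
    rw [hPu b _ ((hP a).takeUntil hb)] at h₂
    omega
  have hself : ∀ x, x ∈ A x := fun x => (hA x x).2 (Walk.end_mem_support _)
  have hroot : ∀ x, r ∈ A x := fun x => (hA x r).2 (Walk.start_mem_support _)
  have hpar : ∀ x, x ≠ r → ∃ u, G.Adj x u ∧ x ∉ A u ∧ A x = insert x (A u) := by
    intro x hx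
    have hadj := (P x).adj_penultimate (Walk.not_nil_of_ne hx.symm)
    have hmem : (P x).penultimate ∈ A x := (hA _ _).2 (Walk.getVert_mem_support _ _)
    have hnot := hasymm _ _ hadj.ne hmem
    exact ⟨_, hadj.symm, hnot, hins _ _ hadj hnot⟩
  choose! par hadj hnot heq using hpar
  have hR : IsRooted r par A := by
    refine ⟨?_, hnot, heq⟩
    have := hPu r Walk.nil Walk.IsPath.nil
    ext z
    rw [hA, ← this]
    simp
  have hchild : ∀ a b, G.Adj a b → b ∉ A a → b ≠ r ∧ par b = a := by
    intro a b hab hb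
    have hbr : b ≠ r := by
      rintro rfl
      exact hb (hroot a)
    refine ⟨hbr, hR.antisymm ?_ ?_⟩
    · have : par b ∈ A b := (hR.mem_iff hbr _).2 (.inr (hself _))
      rw [hins a b hab hb, Finset.mem_insert] at this
      exact this.resolve_left (hadj b hbr).ne.symm
    · have : a ∈ A b := by
        rw [hins a b hab hb]
        exact Finset.mem_insert_of_mem (hself a)
      exact ((hR.mem_iff hbr a).1 this).resolve_left hab.ne
  refine ⟨par, A, hR, hadj, fun a b hab => ?_, fun x p hp => by rw [hPu x p hp]⟩
  by_cases hb : b ∈ A a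
  · exact .inr (hchild b a hab.symm (hasymm b a hab.ne.symm hb))
  · exact .inl (hchild a b hab hb)

namespace IsRooted

variable {r : V} {par : V → V} {A : V → Finset V}

theorem parent_edge_inj (h : IsRooted r par A) {x y : V} (hx : x ≠ r) (hy : y ≠ r)
    (he : s(x, par x) = s(y, par y)) : x = y := by
  rcases Sym2.eq_iff.1 he with ⟨hxy, -⟩ | ⟨hxy, hyx⟩
  · exact hxy
  · exact h.antisymm (hxy ▸ (h.mem_iff hy _).2 (.inr (h.self_mem _)))
      (hyx ▸ (h.mem_iff hx _).2 (.inr (h.self_mem _)))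

theorem odd_count_edges_iff (h : IsRooted r par A)
    (hadj : ∀ a b, G.Adj a b → (b ≠ r ∧ par b = a) ∨ (a ≠ r ∧ par a = b))
    {z : V} (hz : z ≠ r) {u v : V} (w : G.Walk u v) :
    Odd (w.edges.count s(z, par z)) ↔ z ∈ symmDiff (A u) (A v) := by
  induction w with
  | nil => simp
  | @cons a b c hab w ih =>
    have hstep : s(a, b) = s(z, par z) ↔ z ∈ symmDiff (A a) (A b) := by
      rw [Finset.mem_symmDiff]
      rcases hadj a b hab with ⟨hb, rfl⟩ | ⟨ha, rfl⟩
      · have := h.mem_iff hb z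
        have := h.notMem_parent b hb
        constructor
        · intro he
          rw [Sym2.eq_swap] at he
          have := h.parent_edge_inj hb hz he
          grind
        · intro hzz
          have : z = b := by grind
          rw [this, Sym2.eq_swap]
      · have := h.mem_iff ha z
        have := h.notMem_parent a ha
        constructor
        · intro he
          have := h.parent_edge_inj ha hz he
          grind
        · intro hzz
          have : z = a := by grind
          rw [this]
    rw [Walk.edges_cons, List.count_cons]
    rw [Finset.mem_symmDiff] at ih hstep ⊢
    by_cases he : s(a, b) = s(z, par z)
    · simp only [he, beq_self_eq_true, if_true, Nat.odd_add_one]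
      grind
    · simp only [beq_iff_eq, he, if_false, add_zero]
      grind

theorem mem_edges_iff (h : IsRooted r par A)
    (hadj : ∀ a b, G.Adj a b → (b ≠ r ∧ par b = a) ∨ (a ≠ r ∧ par a = b))
    {x y z : V} (hx : x ≠ r) (hy : y ≠ r) (hz : z ≠ r) (hzx : z ≠ x) (hzy : z ≠ y) {u v : V}
    {w : G.Walk u v} (hw : w.IsPath) (hu : u ∈ s(x, par x)) (hv : v ∈ s(y, par y)) :
    s(z, par z) ∈ w.edges ↔ z ∈ symmDiff (A x) (A y) := by
  have hend : ∀ x', x' ≠ r → z ≠ x' → ∀ a ∈ s(x', par x'), z ∈ A a ↔ z ∈ A x' := by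
    intro x' hx' hne a ha
    have := h.mem_iff hx' z
    rcases Sym2.mem_iff.1 ha with rfl | rfl
    · rfl
    · tauto
  have key := h.odd_count_edges_iff hadj hz w
  rw [hw.isTrail.edges_nodup.count] at key
  rw [Finset.mem_symmDiff, hend x hx hzx u hu, hend y hy hzy v hv] at key
  rw [Finset.mem_symmDiff, ← key]
  by_cases hm : s(z, par z) ∈ w.edges <;> simp [hm]

end IsRooted

end Tree

/-- **Theorem.** If a finite tree `G` has a path containing all its vertices of degree 3
or more, then `G` is friendly to the simple path. -/
theorem tree_with_trunk_friendly_to_path {V : Type*} [Fintype V] [DecidableEq V]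
    (G : SimpleGraph V) [DecidableRel G.Adj] (hT : G.IsTree)
    (hpath : ∃ (u v : V) (p : G.Walk u v), p.IsPath ∧
      ∀ x : V, 3 ≤ G.degree x → x ∈ p.support) :
    FriendlyToPath G := by
  obtain ⟨r, t, p, hp, hdeg⟩ := hpath
  obtain ⟨par, A, h, hpar, hadj, hA⟩ := exists_isRooted hT r
  have hbr : ∀ x y, x ≠ r → y ≠ r → par x = par y → x ≠ y → par x ∈ A t := by
    intro x y hx hy hxy hne
    by_cases hr : par x = r
    · exact hr ▸ h.root_mem t
    rw [hA t p hp, List.mem_toFinset]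
    apply hdeg
    have hout : ∀ c, c ≠ r → par c = par x → c ≠ par (par x) := by
      intro c hc hcx hcp
      refine h.notMem_parent c hc ?_
      rw [hcx, hcp]
      exact (h.mem_iff hr _).2 (.inr (h.self_mem _))
    have hsub : ({x, y, par (par x)} : Finset V) ⊆ G.neighborFinset (par x) := by
      intro a ha
      rw [mem_neighborFinset]
      simp only [Finset.mem_insert, Finset.mem_singleton] at ha
      rcases ha with rfl | rfl | rfl
      · exact (hpar _ hx).symm
      · exact hxy ▸ (hpar _ hy).symm
      · exact hpar _ hr
    have hcard := Finset.card_le_card hsub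
    rw [Finset.card_eq_three.2 ⟨x, y, par (par x), hne, hout x hx rfl, hout y hy hxy.symm, rfl⟩,
      card_neighborFinset_eq_degree] at hcard
    exact hcard
  obtain ⟨s, hs, hmem⟩ := h.exists_segment hbr r
  have hmem' : ∀ d, d ∈ s ↔ d ≠ r := fun d => by simp [hmem, h.root_mem]
  have hlen : s.length = G.edgeFinset.card := by
    have h₁ : s.toFinset = Finset.univ.erase r := by
      ext d
      simp [hmem']
    have h₂ := congrArg Finset.card h₁
    rw [List.toFinset_card_of_nodup hs.nodup, Finset.card_erase_of_mem (Finset.mem_univ r),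
      Finset.card_univ, ← hT.card_edgeFinset] at h₂
    simpa using h₂
  have hne : ∀ i (hi : i < s.length), s[i] ≠ r := fun i hi => (hmem' _).1 (List.getElem_mem hi)
  refine ⟨fun i => s(s[i.1]'(i.2.trans_eq hlen.symm), par (s[i.1]'(i.2.trans_eq hlen.symm))),
    ?_, ?_, ?_⟩
  · intro i
    rw [mem_edgeFinset, mem_edgeSet]
    exact hpar _ (hne _ _)
  · intro i j hij
    exact Fin.ext ((hs.nodup.getElem_inj_iff).1 (h.parent_edge_inj (hne _ _) (hne _ _) hij))
  · intro k a hk ha hka u v w hw hu hv hku hkv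
    by_cases hak : a = k
    · subst hak
      exact iff_of_false hku hkv
    · have hki : k + 1 < s.length := hlen ▸ hk
      have hai : a + 1 < s.length := hlen ▸ ha
      have hd : ∀ i j (hi : i < s.length) (hj : j < s.length), i ≠ j → s[i] ≠ s[j] :=
        fun i j hi hj hij he => hij (hs.nodup.getElem_inj_iff.1 he)
      have hne₁ := hd a k (by omega) (by omega) hak
      have hne₂ := hd a (k + 1) (by omega) hki (by omega)
      have hne₃ := hd (a + 1) k hai (by omega) (by omega)
      have hne₄ := hd (a + 1) (k + 1) hai hki (by omega)
      exact (h.mem_edges_iff hadj (hne _ _) (hne _ _) (hne _ _) hne₁ hne₂ hw hu hv).trans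
        (((hs.friendly [] (List.disjoint_nil_left _)).mem_iff hki hai hka hak).trans
          (h.mem_edges_iff hadj (hne _ _) (hne _ _) (hne _ _) hne₃ hne₄ hw hu hv).symm)
end

section
/- Let G be a finite tree. Suppose there exists a vertex C of G such that the distances from C to all leaves of G are equal, and suppose every vertex of G that is not a leaf has even degree. Then G is friendly to the simple path, i.e., there exists a bijection (numbering) from the edge set of G to {1,…,|E(G)|} such that for every k and every integer s, the path between the edges numbered k and k+1 contains either both of the edges numbered k+2s and k+2s+1 or neither of them. -/
open SimpleGraph

/-- In `l.flatMap c` with all blocks of odd length, consecutive entries come from a common block or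
from consecutive blocks, in which case the index of the first block has the parity of the index of
the first entry. -/
theorem List.getElem?_flatMap_succ_of_odd {α β : Type*} (c : α → List β) (l : List α)
    (hc : ∀ v ∈ l, Odd (c v).length) (p : ℕ) (x y : β)
    (hx : (l.flatMap c)[p]? = some x) (hy : (l.flatMap c)[p + 1]? = some y) :
    (∃ v ∈ l, x ∈ c v ∧ y ∈ c v) ∨
      ∃ i v w, l[i]? = some v ∧ l[i + 1]? = some w ∧ x ∈ c v ∧ y ∈ c w ∧ i % 2 = p % 2 := by
  induction l generalizing p with
  | nil => simp at hx
  | cons v t ih =>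
    have hv : Odd (c v).length := hc v (by simp)
    have ht : ∀ u ∈ t, Odd (c u).length := fun u hu => hc u (by simp [hu])
    rw [List.flatMap_cons] at hx hy
    rcases lt_trichotomy (p + 1) (c v).length with h | h | h
    · rw [List.getElem?_append_left (by omega)] at hx hy
      exact Or.inl ⟨v, by simp, List.mem_of_getElem? hx, List.mem_of_getElem? hy⟩
    · rw [List.getElem?_append_left (by omega)] at hx
      rw [List.getElem?_append_right (by omega), h, Nat.sub_self] at hy
      cases t with
      | nil => simp at hy
      | cons w t =>
        have hw : Odd (c w).length := ht w (by simp)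
        rw [List.flatMap_cons, List.getElem?_append_left hw.pos] at hy
        refine Or.inr ⟨0, v, w, by simp, by simp, List.mem_of_getElem? hx,
          List.mem_of_getElem? hy, ?_⟩
        rcases hv with ⟨r, hr⟩
        omega
    · rw [List.getElem?_append_right (by omega)] at hx hy
      rw [show p + 1 - (c v).length = p - (c v).length + 1 by omega] at hy
      rcases ih ht _ hx hy with ⟨u, hu, h₁, h₂⟩ | ⟨i, u, w, h₁, h₂, h₃, h₄, h₅⟩
      · exact Or.inl ⟨u, by simp [hu], h₁, h₂⟩
      · refine Or.inr ⟨i + 1, u, w, by simpa using h₁, by simpa using h₂, h₃, h₄, ?_⟩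
        rcases hv with ⟨r, hr⟩
        omega

theorem List.even_length_flatMap_iff_of_odd {α β : Type*} (c : α → List β) (l : List α)
    (hc : ∀ v ∈ l, Odd (c v).length) : Even (l.flatMap c).length ↔ Even l.length := by
  induction l with
  | nil => simp
  | cons v t ih =>
    have hv : Odd (c v).length := hc v (by simp)
    have ht := ih fun u hu => hc u (by simp [hu])
    rw [List.flatMap_cons, List.length_append, List.length_cons, Nat.even_add, Nat.even_add_one,
      ht, ← Nat.not_odd_iff_even]
    tauto

theorem List.mem_of_getElem?_zero_flatMap {α β : Type*} (c : α → List β) (l : List α) {v : α}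
    (hv : l[0]? = some v) (hc : c v ≠ []) {y : β} (hy : (l.flatMap c)[0]? = some y) : y ∈ c v := by
  cases l with
  | nil => simp at hv
  | cons u t =>
    obtain rfl : u = v := by simpa using hv
    rw [List.flatMap_cons, List.getElem?_append_left (List.length_pos_iff.mpr hc)] at hy
    exact List.mem_of_getElem? hy

/-- Breadth-first levels in which the direction of traversal is reversed at each level. -/
def snakeLevel {V : Type*} (c : V → List V) (r : V) : ℕ → List V
  | 0 => [r]
  | n + 1 => (snakeLevel c r n).reverse.flatMap c

/-- The concatenation of the levels `1, …, n`. -/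
def snake {V : Type*} (c : V → List V) (r : V) : ℕ → List V
  | 0 => []
  | n + 1 => snake c r n ++ snakeLevel c r (n + 1)

theorem snakeLevel_ne_nil {V : Type*} (c : V → List V) (r : V) {n m : ℕ} (hnm : n ≤ m)
    (hm : snakeLevel c r m ≠ []) : snakeLevel c r n ≠ [] := by
  intro hn
  induction m, hnm using Nat.le_induction with
  | base => exact hm hn
  | succ m _ ih => exact ih fun h => hm (by simp [snakeLevel, h])

theorem getElem?_snake {V : Type*} (c : V → List V) (r : V) {n D p : ℕ} {x : V} (hn : n < D)
    (hx : (snakeLevel c r (n + 1))[p]? = some x) :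
    (snake c r D)[(snake c r n).length + p]? = some x := by
  induction D with
  | zero => omega
  | succ D ih =>
    rw [snake]
    rcases Nat.lt_succ_iff_lt_or_eq.mp hn with h | rfl
    · have := ih h
      rwa [List.getElem?_append_left]
      exact (List.getElem?_eq_some_iff.mp this).1
    · rw [List.getElem?_append_right (by omega)]
      simpa using hx

theorem snake_index_succ {V : Type*} (c : V → List V) (r : V) (D k : ℕ)
    (hk : k + 1 < (snake c r D).length) :
    (∃ n p, n < D ∧ p + 1 < (snakeLevel c r (n + 1)).length ∧ k = (snake c r n).length + p) ∨
      ∃ n, n + 1 < D ∧ k + 1 = (snake c r (n + 1)).length := by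
  induction D with
  | zero => simp [snake] at hk
  | succ D ih =>
    rcases lt_trichotomy (k + 1) (snake c r D).length with h | h | h
    · rcases ih h with ⟨n, p, h₁, h₂, h₃⟩ | ⟨n, h₁, h₂⟩
      · exact Or.inl ⟨n, p, by omega, h₂, h₃⟩
      · exact Or.inr ⟨n, by omega, h₂⟩
    · cases D with
      | zero => simp [snake] at h
      | succ D => exact Or.inr ⟨D, by omega, h⟩
    · rw [snake, List.length_append] at hk
      exact Or.inl ⟨D, k - (snake c r D).length, by omega, by omega, by omega⟩

namespace SimpleGraph

variable {V : Type*} {G : SimpleGraph V}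

/-- In a forest, a walk joining endpoints of an edge and avoiding that edge is closed. -/
theorem IsAcyclic.eq_of_mem_edge_of_notMem_edges (hG : G.IsAcyclic) {e : Sym2 V}
    (he : e ∈ G.edgeSet) {u v : V} (hu : u ∈ e) (hv : v ∈ e) (w : G.Walk u v)
    (hw : e ∉ w.edges) : u = v := by
  by_contra h
  obtain rfl : e = s(u, v) := (Sym2.mem_and_mem_iff h).mp ⟨hu, hv⟩
  exact hw (isBridge_iff_forall_walk_mem_edges.mp (isAcyclic_iff_forall_isBridge.mp hG he) w)

theorem exists_walk_edges_subset_of_mem_edge {e : Sym2 V} (he : e ∈ G.edgeSet) {u v : V}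
    (hu : u ∈ e) (hv : v ∈ e) : ∃ w : G.Walk u v, ∀ d ∈ w.edges, d = e := by
  by_cases h : u = v
  · subst h
    exact ⟨.nil, by simp⟩
  · obtain rfl : e = s(u, v) := (Sym2.mem_and_mem_iff h).mp ⟨hu, hv⟩
    exact ⟨.cons (show G.Adj u v from he) .nil, by simp⟩

/-- In a forest, all paths between two distinct edges that avoid these edges have the same
edges. -/
theorem IsAcyclic.edges_eq_of_path_between (hG : G.IsAcyclic) {e f : Sym2 V}
    (he : e ∈ G.edgeSet) (hf : f ∈ G.edgeSet) (hef : e ≠ f) {u v u' v' : V}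
    (hu : u ∈ e) (hu' : u' ∈ e) (hv : v ∈ f) (hv' : v' ∈ f)
    (p : G.Walk u v) (q : G.Walk u' v') (hp : p.IsPath) (hq : q.IsPath)
    (hpe : e ∉ p.edges) (hpf : f ∉ p.edges) (hqe : e ∉ q.edges) (hqf : f ∉ q.edges) :
    p.edges = q.edges := by
  obtain ⟨a, ha⟩ := exists_walk_edges_subset_of_mem_edge he hu hu'
  obtain ⟨b, hb⟩ := exists_walk_edges_subset_of_mem_edge hf hv hv'
  obtain rfl : u = u' := by
    refine hG.eq_of_mem_edge_of_notMem_edges he hu hu' ((p.append b).append q.reverse) ?_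
    simp only [Walk.edges_append, Walk.edges_reverse, List.mem_append, List.mem_reverse, not_or]
    exact ⟨⟨hpe, fun h => hef (hb _ h)⟩, hqe⟩
  obtain rfl : v = v' := by
    refine hG.eq_of_mem_edge_of_notMem_edges hf hv hv' (p.reverse.append q) ?_
    simp only [Walk.edges_append, Walk.edges_reverse, List.mem_append, List.mem_reverse, not_or]
    exact ⟨hpf, hqf⟩
  have := hG.subsingleton_path u v
  exact congrArg (fun r : G.Path u v => r.1.edges) (Subsingleton.elim ⟨p, hp⟩ ⟨q, hq⟩)

/-- In a tree, a vertex has at most one neighbour closer to a given root. -/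
theorem IsTree.eq_of_adj_of_dist_eq_add_one (hG : G.IsTree) {C v w w' : V} (hw : G.Adj w v)
    (hw' : G.Adj w' v) (hd : G.dist C v = G.dist C w + 1) (hd' : G.dist C v = G.dist C w' + 1) :
    w = w' := by
  have key : ∀ u, G.Adj u v → G.dist C v = G.dist C u + 1 →
      ∃ p : G.Walk C v, p.IsPath ∧ p.penultimate = u := by
    intro u hu hd
    obtain ⟨p, hp⟩ := hG.connected.exists_walk_length_eq_dist C u
    refine ⟨p.concat hu, Walk.isPath_of_length_eq_dist _ ?_, by simp⟩
    simp [hp, hd]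
  obtain ⟨p, hp, hpw⟩ := key w hw hd
  obtain ⟨q, hq, hqw⟩ := key w' hw' hd'
  rw [← hpw, ← hqw, (hG.existsUnique_path C v).unique hp hq]

/-- `par` maps each vertex other than the root `C` to its unique neighbour closer to `C`. -/
def IsParent (G : SimpleGraph V) (C : V) (par : V → V) : Prop :=
  ∀ v w, G.Adj w v ∧ G.dist C v = G.dist C w + 1 ↔ v ≠ C ∧ par v = w

theorem IsTree.exists_isParent (hG : G.IsTree) (C : V) : ∃ par, G.IsParent C par := by
  have h : ∀ v, ∃ w, v ≠ C → G.Adj w v ∧ G.dist C v = G.dist C w + 1 := by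
    intro v
    by_cases hv : v = C
    · exact ⟨v, fun h => absurd hv h⟩
    obtain ⟨p, hp⟩ := hG.connected.exists_walk_length_eq_dist v C
    cases p with
    | nil => exact absurd rfl hv
    | @cons _ w _ hw p =>
      refine ⟨w, fun _ => ⟨hw.symm, ?_⟩⟩
      have h₁ := dist_le p
      rw [Walk.length_cons, dist_comm] at hp
      rw [dist_comm] at h₁
      have h₂ := hG.dist_eq_dist_add_one_of_adj C hw
      omega
  choose par hpar using h
  refine ⟨par, fun v w => ⟨fun ⟨h₁, h₂⟩ => ?_, ?_⟩⟩
  · have hv : v ≠ C := by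
      rintro rfl
      simp at h₂
    obtain ⟨h₃, h₄⟩ := hpar v hv
    exact ⟨hv, hG.eq_of_adj_of_dist_eq_add_one h₃ h₁ h₄ h₂⟩
  · rintro ⟨hv, rfl⟩
    exact hpar v hv

namespace IsParent

variable {C : V} {par : V → V}

theorem adj (h : G.IsParent C par) {v : V} (hv : v ≠ C) : G.Adj (par v) v :=
  ((h v (par v)).mpr ⟨hv, rfl⟩).1

theorem dist_eq (h : G.IsParent C par) {v : V} (hv : v ≠ C) :
    G.dist C v = G.dist C (par v) + 1 :=
  ((h v (par v)).mpr ⟨hv, rfl⟩).2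

theorem edge_mem (h : G.IsParent C par) {v : V} (hv : v ≠ C) : s(v, par v) ∈ G.edgeSet :=
  (h.adj hv).symm

theorem edge_injective (h : G.IsParent C par) {v w : V} (hv : v ≠ C) (hw : w ≠ C)
    (hvw : s(v, par v) = s(w, par w)) : v = w := by
  rcases Sym2.eq_iff.mp hvw with ⟨h₁, -⟩ | ⟨h₁, h₂⟩
  · exact h₁
  · have h₃ := h.dist_eq hv
    have h₄ := h.dist_eq hw
    rw [h₂] at h₃
    rw [← h₁] at h₄
    omega

end IsParent

/-- The path between the parent edges of the vertices `x` and `y` at distance `n` from `C` stays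
at distance less than `n` from `C`, and it is compatible with the pairs of consecutive edges of the
numbering `F` that start at a position with the parity of `k`. -/
def Linked (G : SimpleGraph V) (C : V) (par : V → V) (F : List V) (k n : ℕ) (x y : V) : Prop :=
  ∃ q : G.Walk (par x) (par y), q.IsPath ∧ (∀ z ∈ q.support, G.dist C z < n) ∧
    ∀ a u v, F[a]? = some u → F[a + 1]? = some v → a % 2 = k % 2 →
      (s(u, par u) ∈ q.edges ↔ s(v, par v) ∈ q.edges)

variable {C : V} {par : V → V} {F : List V}

theorem Linked.symm {k n : ℕ} {x y : V} (h : G.Linked C par F k n x y) :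
    G.Linked C par F k n y x := by
  obtain ⟨q, hq, hs, ha⟩ := h
  refine ⟨q.reverse, hq.reverse, by simpa using hs, ?_⟩
  simpa using ha

theorem linked_of_par_eq {k n : ℕ} {x y : V} (hxy : par x = par y)
    (hn : G.dist C (par x) < n) : G.Linked C par F k n x y := by
  unfold Linked
  rw [← hxy]
  exact ⟨.nil, by simp, by simpa using hn, by simp⟩

/-- Extending the path between the parent edges of the consecutive vertices `x`, `y` of `F` to
their children. -/
theorem Linked.extend (hpar : G.IsParent C par) (hF : F.Nodup) (hFC : C ∉ F) {k i n : ℕ}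
    {x y x' y' : V} (hx : F[i]? = some x) (hy : F[i + 1]? = some y) (hik : i % 2 = k % 2)
    (hxn : G.dist C x = n) (hyn : G.dist C y = n) (hx' : par x' = x) (hy' : par y' = y)
    (h : G.Linked C par F i n x y) : G.Linked C par F k (n + 1) x' y' := by
  obtain ⟨q, hq, hs, ha⟩ := h
  have hne : ∀ {j : ℕ} {u : V}, F[j]? = some u → u ≠ C := fun hu hC =>
    hFC (hC ▸ List.mem_of_getElem? hu)
  have hinj : ∀ {a b : ℕ} {u v : V}, F[a]? = some u → F[b]? = some v →
      (s(u, par u) = s(v, par v) ↔ a = b) := by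
    intro a b u v hu hv
    refine ⟨fun huv => ?_, ?_⟩
    · have := hpar.edge_injective (hne hu) (hne hv) huv
      exact (List.getElem?_inj (List.getElem?_eq_some_iff.mp hu).1 hF).mp (by rw [hu, hv, this])
    · rintro rfl
      rw [Option.some_injective _ (hu.symm.trans hv)]
  have hxq : x ∉ q.support := fun hm => by
    have := hs _ hm
    omega
  have hyq : y ∉ q.support := fun hm => by
    have := hs _ hm
    omega
  have hxy : x ≠ y := fun hxy => by
    have := (hinj hx hy).mp (by rw [hxy])
    omega
  unfold Linked
  rw [hx', hy']
  refine ⟨(q.concat (hpar.adj (hne hy))).cons (hpar.adj (hne hx)).symm, ?_, ?_, ?_⟩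
  · rw [Walk.cons_isPath_iff]
    refine ⟨hq.concat hyq _, ?_⟩
    simp [Walk.support_concat, hxq, hxy]
  · intro z hz
    simp only [Walk.support_cons, Walk.support_concat, List.mem_cons, List.mem_append,
      List.not_mem_nil, or_false] at hz
    rcases hz with rfl | hz | rfl
    · omega
    · have := hs _ hz
      omega
    · omega
  · intro a u v hu hv hak
    have h₁ := ha a u v hu hv (by omega)
    simp only [Walk.edges_cons, Walk.edges_concat, List.mem_cons, List.concat_eq_append,
      List.mem_append, List.not_mem_nil, or_false]
    rw [Sym2.eq_swap (a := par y) (b := y), hinj hu hx, hinj hu hy, hinj hv hx, hinj hv hy, h₁]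
    have h₂ : a ≠ i + 1 := by omega
    have h₃ : a + 1 ≠ i := by omega
    simp only [h₂, h₃, or_false, false_or, Nat.add_right_cancel_iff]
    tauto

/-- Consecutive vertices of a level are linked. -/
theorem linked_snakeLevel (hpar : G.IsParent C par) {c : V → List V}
    (hc : ∀ v w, w ∈ c v ↔ w ≠ C ∧ par w = v) {D : ℕ} (hF : (snake c C D).Nodup)
    (hFC : C ∉ snake c C D) (hlev : ∀ n v, v ∈ snakeLevel c C n ↔ G.dist C v = n)
    (hodd : ∀ n, 0 < n → n < D → ∀ v ∈ snakeLevel c C n, Odd (c v).length)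
    (heven : ∀ n, Even (snakeLevel c C (n + 1)).length)
    (hevenF : ∀ n, Even (snake c C n).length) {n : ℕ} (hn : n < D) {p : ℕ} {x y : V}
    (hx : (snakeLevel c C (n + 1))[p]? = some x)
    (hy : (snakeLevel c C (n + 1))[p + 1]? = some y) :
    G.Linked C par (snake c C D) p (n + 1) x y := by
  induction n generalizing p x y with
  | zero =>
    have hx := List.mem_of_getElem? hx
    have hy := List.mem_of_getElem? hy
    simp only [snakeLevel, List.reverse_singleton, List.flatMap_singleton, hc] at hx hy
    exact linked_of_par_eq (hx.2.trans hy.2.symm) (by simp [hx.2])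
  | succ n ih =>
    rw [snakeLevel] at hx hy
    rcases List.getElem?_flatMap_succ_of_odd c _
      (fun v hv => hodd (n + 1) (by omega) hn v (List.mem_reverse.mp hv)) p x y hx hy with
      ⟨v, hv, hxv, hyv⟩ | ⟨i, v, w, hv, hw, hxv, hyw, hip⟩
    · rw [hc] at hxv hyv
      rw [List.mem_reverse, hlev] at hv
      exact linked_of_par_eq (hxv.2.trans hyv.2.symm) (by rw [hxv.2]; omega)
    · rw [hc] at hxv hyw
      have hil := (List.getElem?_eq_some_iff.mp hw).1
      rw [List.length_reverse] at hil
      rw [List.getElem?_reverse (by omega)] at hv hw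
      obtain ⟨r, hr⟩ := heven n
      obtain ⟨s, hs⟩ := hevenF n
      set N := (snakeLevel c C (n + 1)).length with hN
      rw [show N - 1 - i = N - 1 - (i + 1) + 1 by omega] at hv
      set j := N - 1 - (i + 1) with hj
      obtain ⟨q, hq⟩ := ih (by omega) hw hv
      refine (Linked.extend hpar hF hFC (getElem?_snake c C (D := D) (by omega) hw)
        (getElem?_snake c C (D := D) (by omega) hv) (k := p) (by omega)
        ((hlev _ _).mp (List.mem_of_getElem? hw)) ((hlev _ _).mp (List.mem_of_getElem? hv))
        hyw.2 hxv.2 ?_).symm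
      refine ⟨q, hq.1, hq.2.1, fun a u v hu hv h => hq.2.2 a u v hu hv ?_⟩
      omega

namespace IsParent

variable {c : V → List V}

theorem mem_snakeLevel (hpar : G.IsParent C par) (hconn : G.Connected)
    (hc : ∀ v w, w ∈ c v ↔ w ≠ C ∧ par w = v) (n : ℕ) (v : V) :
    v ∈ snakeLevel c C n ↔ G.dist C v = n := by
  induction n generalizing v with
  | zero => rw [snakeLevel, List.mem_singleton, hconn.dist_eq_zero_iff, eq_comm]
  | succ n ih =>
    simp only [snakeLevel, List.mem_flatMap, List.mem_reverse, ih, hc]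
    constructor
    · rintro ⟨_, hu, hv, rfl⟩
      rw [hpar.dist_eq hv, hu]
    · intro hv
      have hvC : v ≠ C := by
        rintro rfl
        simp at hv
      have := hpar.dist_eq hvC
      exact ⟨par v, by omega, hvC, rfl⟩

theorem nodup_snakeLevel (hc : ∀ v w, w ∈ c v ↔ w ≠ C ∧ par w = v) (hcn : ∀ v, (c v).Nodup)
    (n : ℕ) : (snakeLevel c C n).Nodup := by
  induction n with
  | zero => simp [snakeLevel]
  | succ n ih =>
    refine List.nodup_flatMap.mpr ⟨fun v _ => hcn v, ?_⟩
    refine (List.nodup_reverse.mpr ih).imp fun {u v} huv => ?_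
    rw [Function.onFun, List.disjoint_left]
    intro w hu hv
    rw [hc] at hu hv
    exact huv (hu.2.symm.trans hv.2)

theorem mem_snake (hpar : G.IsParent C par) (hconn : G.Connected)
    (hc : ∀ v w, w ∈ c v ↔ w ≠ C ∧ par w = v) (n : ℕ) (v : V) :
    v ∈ snake c C n ↔ 0 < G.dist C v ∧ G.dist C v ≤ n := by
  induction n with
  | zero =>
    simp only [snake, List.not_mem_nil, false_iff]
    omega
  | succ n ih =>
    rw [snake, List.mem_append, ih, hpar.mem_snakeLevel hconn hc]
    omega

theorem nodup_snake (hpar : G.IsParent C par) (hconn : G.Connected)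
    (hc : ∀ v w, w ∈ c v ↔ w ≠ C ∧ par w = v) (hcn : ∀ v, (c v).Nodup) (n : ℕ) :
    (snake c C n).Nodup := by
  induction n with
  | zero => simp [snake]
  | succ n ih =>
    refine ih.append (nodup_snakeLevel hc hcn _) ?_
    intro v h₁ h₂
    rw [hpar.mem_snake hconn hc] at h₁
    rw [hpar.mem_snakeLevel hconn hc] at h₂
    omega

theorem adj_iff (hpar : G.IsParent C par) (hG : G.IsTree) (v w : V) :
    G.Adj v w ↔ (v ≠ C ∧ par v = w) ∨ (w ≠ C ∧ par w = v) := by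
  rw [← hpar, ← hpar]
  constructor
  · intro h
    rcases hG.dist_eq_dist_add_one_of_adj C h with h' | h'
    · exact Or.inl ⟨h.symm, h'⟩
    · exact Or.inr ⟨h, h'⟩
  · rintro (h | h)
    · exact h.1.symm
    · exact h.1

theorem degree_eq (hpar : G.IsParent C par) (hG : G.IsTree) [Fintype V] [DecidableEq V]
    [DecidableRel G.Adj] (hc : ∀ v w, w ∈ c v ↔ w ≠ C ∧ par w = v) (hcn : ∀ v, (c v).Nodup)
    (v : V) : G.degree v = (c v).length + if v = C then 0 else 1 := by
  rw [← card_neighborFinset_eq_degree, ← List.toFinset_card_of_nodup (hcn v)]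
  split_ifs with hv
  · rw [add_zero]
    congr 1
    ext w
    simp [hpar.adj_iff hG, hc, hv]
  · rw [← Finset.card_insert_of_notMem (a := par v)]
    · congr 1
      ext w
      simp [hpar.adj_iff hG, hc, hv, eq_comm]
    · rw [List.mem_toFinset, hc]
      rintro ⟨h₁, h₂⟩
      have h₃ := hpar.dist_eq hv
      have h₄ := hpar.dist_eq h₁
      rw [h₂] at h₄
      omega

end IsParent

end SimpleGraph

/-- **Theorem.** If a finite tree `G` has a vertex `C` equidistant from all its leaves and
all its non-leaf vertices have even degree, then `G` is friendly to the simple path. -/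
theorem parity_and_center_friendly_to_path {V : Type*} [Fintype V] [DecidableEq V]
    (G : SimpleGraph V) [DecidableRel G.Adj] (hT : G.IsTree)
    (hC : ∃ C : V, ∀ x y : V, G.degree x = 1 → G.degree y = 1 → G.dist C x = G.dist C y)
    (hdeg : ∀ x : V, G.degree x ≠ 1 → Even (G.degree x)) :
    FriendlyToPath G := by
  obtain ⟨C, hC⟩ := hC
  have hconn := hT.connected
  obtain ⟨par, hpar⟩ := hT.exists_isParent C
  let c : V → List V := fun v => (Finset.univ.filter fun w => w ≠ C ∧ par w = v).toList
  have hc : ∀ v w, w ∈ c v ↔ w ≠ C ∧ par w = v := by simp [c]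
  have hcn : ∀ v, (c v).Nodup := fun v => Finset.nodup_toList _
  have hlev := hpar.mem_snakeLevel hconn hc
  have hdegree := hpar.degree_eq hT hc hcn
  obtain ⟨z, -, hz⟩ := Finset.exists_max_image Finset.univ (G.dist C) ⟨C, Finset.mem_univ C⟩
  set D := G.dist C z with hD
  have hzmax : ∀ v, G.dist C v ≤ D := fun v => hz v (Finset.mem_univ v)
  have hcnil : ∀ v, D ≤ G.dist C v → c v = [] := by
    intro v hv
    rw [List.eq_nil_iff_forall_not_mem]
    intro w hw
    obtain ⟨hwC, rfl⟩ := (hc v w).mp hw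
    have := hpar.dist_eq hwC
    have := hzmax w
    omega
  have heven_degree : ∀ v, G.dist C v < D → Even (G.degree v) := by
    intro v hv
    refine hdeg v fun hv₁ => ?_
    have hzC : z ≠ C := by
      rintro rfl
      simp [hD] at hv
    have := hC v z hv₁ (by rw [hdegree, hcnil z le_rfl, if_neg hzC]; rfl)
    omega
  have hodd : ∀ n, 0 < n → n < D → ∀ v ∈ snakeLevel c C n, Odd (c v).length := by
    intro n hn hnD v hv
    rw [hlev] at hv
    have hvC : v ≠ C := by
      rintro rfl
      simp at hv
      omega
    have := heven_degree v (by omega)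
    rw [hdegree, if_neg hvC] at this
    rwa [Nat.even_add_one, Nat.not_even_iff_odd] at this
  have heven : ∀ n, Even (snakeLevel c C (n + 1)).length := by
    intro n
    induction n with
    | zero =>
      rw [snakeLevel, snakeLevel, List.reverse_singleton, List.flatMap_singleton]
      rcases Nat.eq_zero_or_pos D with h | h
      · simp [hcnil C (by omega)]
      · have := heven_degree C (by simpa using h)
        rwa [hdegree, if_pos rfl] at this
    | succ n ih =>
      rw [snakeLevel]
      rcases lt_or_ge (n + 1) D with h | h
      · rwa [List.even_length_flatMap_iff_of_odd, List.length_reverse]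
        exact fun v hv => hodd (n + 1) (by omega) h v (List.mem_reverse.mp hv)
      · rw [List.flatMap_eq_nil_iff.mpr]
        · simp
        · intro v hv
          rw [List.mem_reverse, hlev] at hv
          exact hcnil v (by omega)
  have hevenF : ∀ n, Even (snake c C n).length := by
    intro n
    induction n with
    | zero => simp [snake]
    | succ n ih =>
      rw [snake, List.length_append]
      exact ih.add (heven n)
  have hF := hpar.nodup_snake hconn hc hcn D
  have hmem := hpar.mem_snake hconn hc D
  have hFC : C ∉ snake c C D := by simp [hmem]
  set F := snake c C D with hFdef
  have hlength : F.length = G.edgeFinset.card := by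
    have h₁ : F.toFinset = Finset.univ.erase C := by
      ext v
      have := hzmax v
      have := hconn.dist_eq_zero_iff (u := C) (v := v)
      simp only [List.mem_toFinset, hmem, Finset.mem_erase, Finset.mem_univ, and_true, ne_eq,
        eq_comm (a := v), ← this]
      omega
    have h₂ := hT.card_edgeFinset
    rw [← List.toFinset_card_of_nodup hF, h₁, Finset.card_erase_of_mem (Finset.mem_univ C),
      Finset.card_univ]
    omega
  have hne : ∀ {k : ℕ} {v : V}, F[k]? = some v → v ≠ C := fun hv h =>
    hFC (h ▸ List.mem_of_getElem? hv)
  let vert : Fin G.edgeFinset.card → V := fun i => F[i.1]'(i.2.trans_eq hlength.symm)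
  have hvert : ∀ i, F[i.1]? = some (vert i) := fun i => List.getElem?_eq_getElem _
  have hinj : Function.Injective fun i => s(vert i, par (vert i)) := by
    intro i j hij
    have h := hpar.edge_injective (hne (hvert i)) (hne (hvert j)) hij
    exact Fin.ext ((hF.getElem_inj_iff).mp h)
  refine ⟨fun i => s(vert i, par (vert i)), fun i => ?_, hinj, ?_⟩
  · exact mem_edgeFinset.mpr (hpar.edge_mem (hne (hvert i)))
  intro k a hk ha hak u v w hw hu hv huw hvw
  have hx := hvert ⟨k, Nat.lt_of_succ_lt hk⟩
  have hy := hvert ⟨k + 1, hk⟩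
  have hab := hvert ⟨a, Nat.lt_of_succ_lt ha⟩
  have hab' := hvert ⟨a + 1, ha⟩
  have hxy := hinj.ne (a₁ := ⟨k, Nat.lt_of_succ_lt hk⟩) (a₂ := ⟨k + 1, hk⟩) (by simp)
  dsimp only at hu hv huw hvw hx hy hab hab' hxy ⊢
  generalize vert ⟨k, Nat.lt_of_succ_lt hk⟩ = x at *
  generalize vert ⟨k + 1, hk⟩ = y at *
  have hxC := hne hx
  have hyC := hne hy
  have hunique := fun {u' v'} hu' hv' (q : G.Walk u' v') hq =>
    hT.isAcyclic.edges_eq_of_path_between (hpar.edge_mem hxC) (hpar.edge_mem hyC) hxy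
      hu hu' hv hv' w q hw hq huw hvw
  rcases snake_index_succ c C D k (hk.trans_eq hlength.symm) with ⟨n, p, hn, hp, rfl⟩ | ⟨n, hn, hkn⟩
  · have hx' := List.getElem?_eq_getElem (Nat.lt_of_succ_lt hp)
    have hy' := List.getElem?_eq_getElem hp
    rw [hFdef, getElem?_snake c C hn hx', Option.some_inj] at hx
    rw [hFdef, add_assoc, getElem?_snake c C hn hy', Option.some_inj] at hy
    rw [hx] at hx'
    rw [hy] at hy'
    obtain ⟨q, hq, hs, hqa⟩ := linked_snakeLevel hpar hc hF hFC hlev hodd heven hevenF hn hx' hy'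
    have hxn := (hlev _ _).mp (List.mem_of_getElem? hx')
    have hyn := (hlev _ _).mp (List.mem_of_getElem? hy')
    rw [hunique (Sym2.mem_mk_right _ _) (Sym2.mem_mk_right _ _) q hq]
    · obtain ⟨r, hr⟩ := hevenF n
      exact hqa a _ _ hab hab' (by omega)
    · intro h
      have := hs _ (q.fst_mem_support_of_mem_edges h)
      omega
    · intro h
      have := hs _ (q.fst_mem_support_of_mem_edges h)
      omega
  · have hlen : (snake c C (n + 1)).length =
        (snake c C n).length + (snakeLevel c C (n + 1)).length := by
      rw [snake, List.length_append]
    have hzD : snakeLevel c C D ≠ [] := List.ne_nil_of_mem ((hlev D z).mpr rfl)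
    have hpos₁ := List.length_pos_iff.mpr (snakeLevel_ne_nil c C hn.le hzD)
    have hpos₂ := List.length_pos_iff.mpr (snakeLevel_ne_nil c C (Nat.succ_le_of_lt hn) hzD)
    have hx' := List.getElem?_eq_getElem
      (show (snakeLevel c C (n + 1)).length - 1 < (snakeLevel c C (n + 1)).length by omega)
    have hy' := List.getElem?_eq_getElem hpos₂
    rw [hFdef, show k = (snake c C n).length + ((snakeLevel c C (n + 1)).length - 1) by omega,
      getElem?_snake c C (by omega) hx', Option.some_inj] at hx
    rw [hFdef, hkn, ← add_zero (snake c C (n + 1)).length, getElem?_snake c C hn hy',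
      Option.some_inj] at hy
    rw [hx] at hx'
    rw [hy] at hy'
    have hyx : par y = x := by
      have hxn := hodd (n + 1) (by omega) hn x (List.mem_of_getElem? hx')
      refine ((hc _ _).mp (List.mem_of_getElem?_zero_flatMap c _ ?_
        (List.length_pos_iff.mp hxn.pos) hy')).2
      rwa [List.getElem?_reverse (by omega)]
    rw [hunique (Sym2.mem_mk_left _ _) (by simp [hyx]) (.nil : G.Walk x x) (by simp) (by simp)
      (by simp)]
    simp
end

section
/- Let G be a finite tree possessing a vertex C whose distances to all leaves of G are equal, and in which every non-leaf vertex has even degree. Then there exists a bijection φ: E(G) → {1,…,|E(G)|} (regarding {1,…,m} as the edges of the simple path with m edges, numbered consecutively) which is simultaneously: (1) friendly, meaning that for any two distinct vertices P, Q of G at even distance from each other, the image sets φ(δP) and φ(δQ) are unlinked in the simple path; and (2) leaf-last, meaning that every edge of G not incident to a leaf receives a strictly smaller number than every edge incident to a leaf. -/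
open SimpleGraph

/-- `p` does not catch `q` in `G`: they are disjoint and for any two distinct edges of `p`,
the path in `G` between them contains an even number of edges of `q`. -/
def DoesNotCatch {V : Type*} (G : SimpleGraph V) (p q : Set (Sym2 V)) : Prop :=
  p ∩ q = ∅ ∧
    ∀ e ∈ p, ∀ f ∈ p, e ≠ f →
      ∀ (u v : V) (w : G.Walk u v), w.IsPath → u ∈ e → v ∈ f →
        e ∉ w.edges → f ∉ w.edges →
        Even (w.edges.countP (fun x => @decide (x ∈ q) (Classical.propDecidable _)))

/-- `p` and `q` are unlinked in `G`. -/
def Unlinked {V : Type*} (G : SimpleGraph V) (p q : Set (Sym2 V)) : Prop :=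
  DoesNotCatch G p q ∧ DoesNotCatch G q p

/-- Image of a set of edges of `G₁` under a map of edge sets. -/
def edgeImage {V₁ V₂ : Type*} {G₁ : SimpleGraph V₁} {G₂ : SimpleGraph V₂}
    (φ : G₁.edgeSet → G₂.edgeSet) (s : Set (Sym2 V₁)) : Set (Sym2 V₂) :=
  {e₂ | ∃ e₁ : G₁.edgeSet, (e₁ : Sym2 V₁) ∈ s ∧ (φ e₁ : Sym2 V₂) = e₂}

/-- A bijection of edge sets is friendly if the images of the coboundaries (incidence sets)
of any two distinct vertices at even distance are unlinked. -/
def FriendlyBij {V₁ V₂ : Type*} (G₁ : SimpleGraph V₁) (G₂ : SimpleGraph V₂)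
    (φ : G₁.edgeSet ≃ G₂.edgeSet) : Prop :=
  ∀ P Q : V₁, P ≠ Q → Even (G₁.dist P Q) →
    Unlinked G₂ (edgeImage φ (G₁.incidenceSet P)) (edgeImage φ (G₁.incidenceSet Q))

/-- `G₁` is friendly to `G₂`. -/
def Friendly {V₁ V₂ : Type*} (G₁ : SimpleGraph V₁) (G₂ : SimpleGraph V₂) : Prop :=
  ∃ φ : G₁.edgeSet ≃ G₂.edgeSet, FriendlyBij G₁ G₂ φ

/-- Smaller endpoint of an unordered pair; for the edge `s(i, i+1)` of the path graph this
determines its number in the consecutive numbering. -/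
def sym2Min {α : Type*} [LinearOrder α] (e : Sym2 α) : α :=
  Sym2.lift ⟨fun a b => min a b, fun a b => min_comm a b⟩ e

/-- The `k`-th edge of the path graph. -/
def pathEdge {m : ℕ} (k : Fin m) : Sym2 (Fin (m + 1)) := s(k.castSucc, k.succ)

lemma pathEdge_injective {m : ℕ} : Function.Injective (pathEdge (m := m)) := by
  intro i j h
  simp only [pathEdge, Sym2.eq_iff, Fin.ext_iff, Fin.val_castSucc, Fin.val_succ] at h
  omega

lemma pathEdge_mem_edgeSet {m : ℕ} (k : Fin m) : pathEdge k ∈ (pathGraph (m + 1)).edgeSet := by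
  simp [pathEdge, pathGraph_adj]

lemma exists_pathEdge_eq {m : ℕ} {e : Sym2 (Fin (m + 1))} (he : e ∈ (pathGraph (m + 1)).edgeSet) :
    ∃ k : Fin m, pathEdge k = e := by
  induction e with | _ a b
  rw [mem_edgeSet, pathGraph_adj] at he
  rcases he with h | h
  · exact ⟨⟨a, by omega⟩, Sym2.eq_iff.2 (.inl ⟨rfl, Fin.ext h⟩)⟩
  · exact ⟨⟨b, by omega⟩, Sym2.eq_iff.2 (.inr ⟨rfl, Fin.ext h⟩)⟩

lemma sym2Min_pathEdge {m : ℕ} (k : Fin m) : sym2Min (pathEdge k) = k.castSucc :=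
  min_eq_left (Fin.castSucc_lt_succ (i := k)).le

/-- The edges of the path graph, numbered consecutively. -/
noncomputable def pathEdgeEquiv (m : ℕ) : Fin m ≃ (pathGraph (m + 1)).edgeSet :=
  Equiv.ofBijective (fun k ↦ ⟨pathEdge k, pathEdge_mem_edgeSet k⟩)
    ⟨fun _ _ h ↦ pathEdge_injective (congrArg Subtype.val h),
      fun e ↦ (exists_pathEdge_eq e.2).imp fun _ h ↦ Subtype.ext h⟩

lemma coe_pathEdgeEquiv {m : ℕ} (k : Fin m) : (pathEdgeEquiv m k : Sym2 _) = pathEdge k := rfl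

lemma mem_support_of_pathGraph_walk {n : ℕ} {a b c : Fin n} (w : (pathGraph n).Walk a b)
    (hac : a ≤ c) (hcb : c ≤ b) : c ∈ w.support := by
  induction w with
  | nil => simp [le_antisymm hcb hac]
  | @cons u v _ h p ih =>
    rw [pathGraph_adj] at h
    by_cases huc : u = c
    · simp [huc]
    · exact List.mem_cons_of_mem _ (ih (by simp only [Fin.le_def, Fin.ext_iff] at *; omega) hcb)

lemma pathEdge_mem_edges {m : ℕ} {u v : Fin (m + 1)} (w : (pathGraph (m + 1)).Walk u v) {k : Fin m}
    (huk : (u : ℕ) ≤ k) (hkv : (k : ℕ) < v) : pathEdge k ∈ w.edges := by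
  induction w with
  | nil => omega
  | @cons u x _ h p ih =>
    rw [pathGraph_adj] at h
    rw [Walk.edges_cons, List.mem_cons]
    by_cases hx : (x : ℕ) ≤ k
    · exact .inr (ih hx hkv)
    · refine .inl (Sym2.eq_iff.2 (.inl ⟨Fin.ext ?_, Fin.ext ?_⟩)) <;> simp <;> omega

lemma le_and_lt_of_pathEdge_mem_edges {m : ℕ} {u v : Fin (m + 1)} {w : (pathGraph (m + 1)).Walk u v}
    (hw : w.IsPath) (huv : u ≤ v) {k : Fin m} (hk : pathEdge k ∈ w.edges) :
    (u : ℕ) ≤ k ∧ (k : ℕ) < v := by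
  induction w with
  | nil => simp at hk
  | @cons u x v h p ih =>
    rw [Walk.cons_isPath_iff] at hw
    have hne : u ≠ v := fun h ↦ hw.2 (h ▸ p.end_mem_support)
    have hux : u < x := by
      by_contra! hxu
      exact hw.2 (mem_support_of_pathGraph_walk p hxu huv)
    rw [pathGraph_adj] at h
    rw [Walk.edges_cons, List.mem_cons] at hk
    rw [Fin.lt_def] at hux
    rw [Fin.le_def] at huv
    rw [Ne, Fin.ext_iff] at hne
    rcases hk with hk | hk
    · simp only [pathEdge, Sym2.eq_iff, Fin.ext_iff, Fin.val_castSucc, Fin.val_succ] at hk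
      omega
    · have := ih hw.1 (by rw [Fin.le_def]; omega) hk
      omega

open Classical in
lemma countP_edges_pathGraph {m : ℕ} {u v : Fin (m + 1)} {w : (pathGraph (m + 1)).Walk u v}
    (hw : w.IsPath) (huv : u ≤ v) (q : Set (Fin m)) :
    w.edges.countP (· ∈ pathEdge '' q) =
      (Finset.univ.filter fun k : Fin m ↦ k ∈ q ∧ (u : ℕ) ≤ k ∧ (k : ℕ) < v).card := by
  rw [List.countP_eq_length_filter,
    ← List.toFinset_card_of_nodup (hw.isTrail.edges_nodup.filter _),
    ← Finset.card_image_of_injective _ pathEdge_injective]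
  congr 1
  ext e
  simp only [List.mem_toFinset, List.mem_filter, Finset.mem_image, Finset.mem_filter,
    Finset.mem_univ, true_and, decide_eq_true_eq]
  constructor
  · rintro ⟨he, k, hk, rfl⟩
    exact ⟨k, ⟨hk, le_and_lt_of_pathEdge_mem_edges hw huv he⟩, rfl⟩
  · rintro ⟨k, ⟨hk, h₁, h₂⟩, rfl⟩
    exact ⟨pathEdge_mem_edges w h₁ h₂, k, hk, rfl⟩

open Classical in
lemma doesNotCatch_pathGraph {m : ℕ} {p q : Set (Fin m)} (hpq : Disjoint p q)
    (h : ∀ i ∈ p, ∀ j ∈ p, i < j →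
      Even (Finset.univ.filter fun k : Fin m ↦ k ∈ q ∧ i < k ∧ k < j).card) :
    DoesNotCatch (pathGraph (m + 1)) (pathEdge '' p) (pathEdge '' q) := by
  refine ⟨(Set.disjoint_image_iff pathEdge_injective |>.2 hpq).inter_eq, ?_⟩
  rintro _ ⟨i, hi, rfl⟩ _ ⟨j, hj, rfl⟩ hne u v w hw hu hv hiw hjw
  wlog hij : i < j generalizing i j u v
  · have := this j hj i hi hne.symm v u w.reverse hw.reverse hv hu (by simpa using hjw)
      (by simpa using hiw) (lt_of_le_of_ne (not_lt.1 hij) fun h ↦ hne (h ▸ rfl))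
    rwa [Walk.edges_reverse, List.countP_reverse] at this
  have hij' : (i : ℕ) < j := hij
  have hi' : ¬((u : ℕ) ≤ i ∧ (i : ℕ) < v) := fun h ↦ hiw (pathEdge_mem_edges w h.1 h.2)
  have hj' : ¬((u : ℕ) ≤ j ∧ (j : ℕ) < v) := fun h ↦ hjw (pathEdge_mem_edges w h.1 h.2)
  simp only [pathEdge, Sym2.mem_iff, Fin.ext_iff, Fin.val_castSucc, Fin.val_succ] at hu hv
  have huv : u ≤ v := by rw [Fin.le_def]; omega
  convert h i hi j hj hij using 1
  convert countP_edges_pathGraph hw huv q using 6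
  · rw [Fin.lt_def]; omega
  · rw [Fin.lt_def]; omega

lemma exists_alternating_key {V : Type*} [Fintype V] (d : V → ℕ) (par : V → V) :
    ∃ K : V → ℕ ×ₗ ℤ, Function.Injective K ∧ (∀ x y, d x < d y → K x < K y) ∧
      ∀ x y, d x = d y → d x = d (par x) + 1 → d y = d (par y) + 1 →
        K (par x) < K (par y) → K y < K x := by
  let N := Fintype.card V
  let idx : V ≃ Fin N := Fintype.equivFin V
  let aux : ℕ → V → ℤ := fun n ↦
    n.rec (fun v ↦ (idx v : ℤ)) fun _ f v ↦ (idx v : ℤ) - N * f (par v)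
  have aux_emod (n v) : aux n v % N = idx v := by
    have hlt : ((idx v : ℕ) : ℤ) % N = idx v := Int.emod_eq_of_lt (by positivity) (by simp)
    cases n with
    | zero => exact hlt
    | succ n => simpa [aux, Int.sub_mul_emod_self_left] using hlt
  refine ⟨fun v ↦ toLex (d v, aux (d v) v), fun x y h ↦ ?_, fun x y h ↦ ?_,
    fun x y hxy hx hy h ↦ ?_⟩
  · have h2 : aux (d x) x = aux (d y) y := congrArg Prod.snd (toLex.injective h)
    have h3 : ((idx x : ℕ) : ℤ) = idx y := by rw [← aux_emod (d x), ← aux_emod (d y), h2]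
    exact idx.injective (Fin.ext (by exact_mod_cast h3))
  · exact Prod.Lex.toLex_lt_toLex.2 (.inl h)
  · have hp : d (par x) = d (par y) := by omega
    rw [Prod.Lex.toLex_lt_toLex] at h ⊢
    refine .inr ⟨hxy.symm, ?_⟩
    replace h : aux (d (par x)) (par x) + 1 ≤ aux (d (par y)) (par y) :=
      (h.resolve_left (by simp [hp])).2
    have hx' : aux (d x) x = (idx x : ℤ) - N * aux (d (par x)) (par x) := by rw [hx]
    have hy' : aux (d y) y = (idx y : ℤ) - N * aux (d (par y)) (par y) := by rw [hy]
    have hlt : ((idx y : ℕ) : ℤ) < N := by simp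
    simp only
    rw [hx', hy']
    nlinarith [mul_le_mul_of_nonneg_left h (Int.natCast_nonneg N)]

lemma exists_equiv_fin_lt_iff {α β : Type*} [Fintype α] [LinearOrder β] {f : α → β}
    (hf : Function.Injective f) {m : ℕ} (hm : Fintype.card α = m) :
    ∃ r : α ≃ Fin m, ∀ x y, r x < r y ↔ f x < f y := by
  let _ : LinearOrder α := LinearOrder.lift' f hf
  exact ⟨(Fintype.orderIsoFinOfCardEq α hm).symm.toEquiv,
    fun _ _ ↦ (Fintype.orderIsoFinOfCardEq α hm).symm.lt_iff_lt⟩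

lemma SimpleGraph.Connected.exists_parent {V : Type*} {G : SimpleGraph V} (hG : G.Connected)
    (C : V) : ∃ par : V → V, ∀ v, v ≠ C → G.Adj v (par v) ∧ G.dist C v = G.dist C (par v) + 1 := by
  suffices h : ∀ v, ∃ u, v ≠ C → G.Adj v u ∧ G.dist C v = G.dist C u + 1 from
    ⟨fun v ↦ (h v).choose, fun v ↦ (h v).choose_spec⟩
  intro v
  by_cases hv : v = C
  · exact ⟨v, fun h ↦ (h hv).elim⟩
  obtain ⟨w, hw⟩ := hG.exists_walk_length_eq_dist v C
  cases w with
  | nil => exact (hv rfl).elim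
  | @cons _ u _ h p =>
    refine ⟨u, fun _ ↦ ⟨h, ?_⟩⟩
    have h₁ := dist_le p
    have h₂ := hG.dist_triangle (u := C) (v := u) (w := v)
    rw [dist_eq_one_iff_adj.2 h.symm] at h₂
    rw [Walk.length_cons, dist_comm] at hw
    rw [dist_comm] at h₁
    omega

section Parent

variable {V : Type*} {G : SimpleGraph V} {C : V} {par : V → V}

/-- The map sending each vertex other than the root to the edge leading to its parent. -/
def parentEdge (hpar : ∀ v, v ≠ C → G.Adj v (par v) ∧ G.dist C v = G.dist C (par v) + 1)
    (v : {v // v ≠ C}) : G.edgeSet :=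
  ⟨s(v.1, par v.1), (hpar v.1 v.2).1⟩

lemma parentEdge_bijective [Fintype V] [DecidableEq V] [DecidableRel G.Adj] (hT : G.IsTree)
    (hpar : ∀ v, v ≠ C → G.Adj v (par v) ∧ G.dist C v = G.dist C (par v) + 1) :
    Function.Bijective (parentEdge hpar) := by
  rw [Fintype.bijective_iff_injective_and_card]
  constructor
  · rintro ⟨v, hv⟩ ⟨w, hw⟩ h
    have hv' := (hpar v hv).2
    have hw' := (hpar w hw).2
    rcases Sym2.eq_iff.1 (congrArg Subtype.val h) with h | h
    · exact Subtype.ext h.1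
    · simp only at h
      rw [h.2] at hv'
      rw [← h.1] at hw'
      omega
  · have := hT.card_edgeFinset
    rw [← edgeFinset_card, Fintype.card_subtype_compl, Fintype.card_subtype_eq]
    omega

/-- The non-root vertices whose parent edge is incident to `P`. -/
def parentEdgeStar (C : V) (par : V → V) (P : V) : Set {v // v ≠ C} := {x | x.1 = P ∨ par x.1 = P}

lemma parentEdge_mem_incidenceSet_iff
    (hpar : ∀ v, v ≠ C → G.Adj v (par v) ∧ G.dist C v = G.dist C (par v) + 1)
    (x : {v // v ≠ C}) (P : V) :
    (parentEdge hpar x : Sym2 V) ∈ G.incidenceSet P ↔ x ∈ parentEdgeStar C par P := by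
  simp only [parentEdge, mk'_mem_incidenceSet_iff, parentEdgeStar, Set.mem_ofPred_eq]
  rw [eq_comm (a := P), eq_comm (a := P)]
  exact and_iff_right (hpar x.1 x.2).1

end Parent

lemma SimpleGraph.IsTree.even_dist_add_dist {V : Type*} {G : SimpleGraph V} (hT : G.IsTree)
    (C P Q : V) : Even (G.dist P Q + G.dist C P + G.dist C Q) := by
  suffices h : ∀ {P Q : V} (w : G.Walk P Q), Even (w.length + G.dist C P + G.dist C Q) by
    obtain ⟨w, hw⟩ := hT.connected.exists_walk_length_eq_dist P Q
    exact hw ▸ h w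
  intro P Q w
  induction w with
  | nil => simp [← two_mul]
  | cons h p ih =>
    have h₁ := hT.dist_ne_of_adj C h
    have h₂ := h.diff_dist_adj (u := C)
    rw [Walk.length_cons]
    grind

section Star

variable {V : Type*} {C : V} {par : V → V} {d : V → ℕ}

lemma star_between_or_not_between {K : V → ℕ ×ₗ ℤ} (hd : ∀ v, v ≠ C → d v = d (par v) + 1)
    (hinj : Function.Injective K) (hlt : ∀ x y, d x < d y → K x < K y)
    (hrev : ∀ x y, d x = d y → d x = d (par x) + 1 → d y = d (par y) + 1 →
      K (par x) < K (par y) → K y < K x)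
    {P Q : V} (hPQ : P ≠ Q) (heven : Even (d P + d Q)) {x y : {v // v ≠ C}}
    (hx : x ∈ parentEdgeStar C par P) (hy : y ∈ parentEdgeStar C par P) (hxy : K x < K y) :
    (d y.1 = d Q + 1 ∧ ∀ z ∈ parentEdgeStar C par Q, K x < K z ∧ K z < K y) ∨
      ∀ z ∈ parentEdgeStar C par Q, ¬(K x < K z ∧ K z < K y) := by
  have hdx := hd x.1 x.2
  have hdy := hd y.1 y.2
  have hle : ∀ {u v}, K u < K v → d u ≤ d v := fun {u v} h ↦ by
    by_contra! h'
    exact (hlt _ _ h').asymm h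
  have hxy' := hle hxy
  rcases eq_or_ne (d P) (d Q) with hdPQ | hdPQ
  · rcases hy with hy | hy
    · right
      rintro z hz ⟨-, h⟩
      have := hle h
      rcases hx with hx | hx
      · rw [hx, hy] at hxy
        exact hxy.false
      · rw [hx] at hdx
        rw [hy] at hxy'
        omega
    · rw [hy] at hdy
      rcases (hinj.ne hPQ).lt_or_gt with hK | hK
      · rcases hx with hx | hx
        · left
          refine ⟨by omega, ?_⟩
          rintro z (hz | hz)
          · rw [hx, hz]
            exact ⟨hK, hlt _ _ (by omega)⟩
          · have hdz := hd z.1 z.2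
            rw [hz] at hdz
            rw [hx]
            exact ⟨hlt _ _ (by omega),
              hrev _ _ (by omega) (by rw [hy, hdy]) (by rw [hz, hdz]) (by rwa [hy, hz])⟩
        · right
          rw [hx] at hdx
          rintro z (hz | hz) ⟨h, -⟩
          · have := hle h
            rw [hz] at this
            omega
          · have hdz := hd z.1 z.2
            rw [hz] at hdz
            exact h.asymm
              (hrev _ _ (by omega) (by rw [hx, hdx]) (by rw [hz, hdz]) (by rwa [hx, hz]))
      · right
        rintro z (hz | hz) ⟨h, h'⟩
        · rcases hx with hx | hx
          · rw [hx, hz] at h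
            exact h.asymm hK
          · have := hle h
            rw [hx] at hdx
            rw [hz] at this
            omega
        · have hdz := hd z.1 z.2
          rw [hz] at hdz
          exact h'.asymm
            (hrev _ _ (by omega) (by rw [hz, hdz]) (by rw [hy, hdy]) (by rwa [hy, hz]))
  · right
    rintro z hz ⟨h, h'⟩
    have h₁ := hle h
    have h₂ := hle h'
    have hdz := hd z.1 z.2
    have hx' : d x.1 = d P ∨ d x.1 = d P + 1 := hx.imp (by simp_all) (by rintro rfl; exact hdx)
    have hy' : d y.1 = d P ∨ d y.1 = d P + 1 := hy.imp (by simp_all) (by rintro rfl; exact hdy)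
    have hz' : d z.1 = d Q ∨ d z.1 = d Q + 1 := hz.imp (by simp_all) (by rintro rfl; exact hdz)
    grind

lemma disjoint_parentEdgeStar (hd : ∀ v, v ≠ C → d v = d (par v) + 1) {P Q : V} (hPQ : P ≠ Q)
    (heven : Even (d P + d Q)) :
    Disjoint (parentEdgeStar C par P) (parentEdgeStar C par Q) := by
  rw [Set.disjoint_left]
  rintro x (hx | hx) (hy | hy)
  · exact hPQ (hx.symm.trans hy)
  · have := hd x.1 x.2
    rw [hx] at this hy
    rw [hy] at this
    grind
  · have := hd x.1 x.2
    rw [hy] at this hx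
    rw [hx] at this
    grind
  · exact hPQ (hx.symm.trans hy)

end Star

lemma card_parentEdgeStar {V : Type*} [Fintype V] [DecidableEq V] {G : SimpleGraph V}
    [DecidableRel G.Adj] (hT : G.IsTree) {C : V} {par : V → V}
    (hpar : ∀ v, v ≠ C → G.Adj v (par v) ∧ G.dist C v = G.dist C (par v) + 1) (P : V) :
    (parentEdgeStar C par P).ncard = G.degree P := by
  rw [← card_incidenceFinset_eq_degree, ← Set.ncard_coe_finset]
  refine Set.ncard_congr (fun x _ ↦ (parentEdge hpar x : Sym2 V)) (fun x hx ↦ ?_)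
    (fun x y _ _ h ↦ ?_) fun e he ↦ ?_
  · simpa using (parentEdge_mem_incidenceSet_iff hpar x P).2 hx
  · exact (parentEdge_bijective hT hpar).1 (Subtype.ext h)
  · rw [coe_incidenceFinset] at he
    obtain ⟨x, hx⟩ := (parentEdge_bijective hT hpar).2 ⟨e, he.1⟩
    have hx' : (parentEdge hpar x : Sym2 V) = e := congrArg Subtype.val hx
    exact ⟨x, (parentEdge_mem_incidenceSet_iff hpar x P).1 (hx' ▸ he), hx'⟩

lemma SimpleGraph.IsTree.degree_eq_one_iff_dist_eq {V : Type*} [Fintype V] [DecidableEq V] [Nontrivial V]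
    {G : SimpleGraph V} [DecidableRel G.Adj] (hT : G.IsTree) {C : V}
    (hC : ∀ x y : V, G.degree x = 1 → G.degree y = 1 → G.dist C x = G.dist C y) :
    ∃ M, (∀ v, G.dist C v ≤ M) ∧ ∀ v, G.degree v = 1 ↔ G.dist C v = M := by
  obtain ⟨u, hu⟩ := Finite.exists_max (G.dist C)
  obtain ⟨par, hpar⟩ := hT.connected.exists_parent C
  have hleaf : ∀ v, G.dist C v = G.dist C u → G.degree v = 1 := by
    intro v hv
    obtain ⟨w, hw⟩ := exists_ne C
    have hvC : v ≠ C := by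
      rintro rfl
      have := hT.connected.pos_dist_of_ne hw.symm
      have := hu w
      rw [dist_self] at hv
      omega
    rw [← card_parentEdgeStar hT hpar, Set.ncard_eq_one]
    refine ⟨⟨v, hvC⟩, Set.ext fun x ↦ ⟨?_, fun h ↦ .inl (congrArg Subtype.val h)⟩⟩
    rintro (hx | hx)
    · exact Subtype.ext hx
    · have h₁ := (hpar x.1 x.2).2
      have h₂ := hu x.1
      rw [hx] at h₁
      omega
  exact ⟨_, hu, fun v ↦ ⟨fun h ↦ hC v u h (hleaf u rfl), hleaf v⟩⟩

/-- **Statement.** A finite tree with a vertex equidistant from all leaves and all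
non-leaf vertices of even degree admits a bijection onto the edges of the simple path with
`|E(G)|` edges which is simultaneously friendly and leaf-last (pendant edges receive the
largest numbers). -/
theorem exists_leaflast_friendly_bijection {V : Type*} [Fintype V] [DecidableEq V]
    (G : SimpleGraph V) [DecidableRel G.Adj] (hT : G.IsTree)
    (hC : ∃ C : V, ∀ x y : V, G.degree x = 1 → G.degree y = 1 → G.dist C x = G.dist C y)
    (hdeg : ∀ x : V, G.degree x ≠ 1 → Even (G.degree x)) :
    ∃ φ : G.edgeSet ≃ (SimpleGraph.pathGraph (G.edgeFinset.card + 1)).edgeSet,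
      FriendlyBij G (SimpleGraph.pathGraph (G.edgeFinset.card + 1)) φ ∧
      ∀ e f : G.edgeSet,
        (¬ ∃ x, x ∈ (e : Sym2 V) ∧ G.degree x = 1) →
        (∃ x, x ∈ (f : Sym2 V) ∧ G.degree x = 1) →
        sym2Min ((φ e : Sym2 (Fin (G.edgeFinset.card + 1)))) <
          sym2Min ((φ f : Sym2 (Fin (G.edgeFinset.card + 1)))) := by
  classical
  rcases subsingleton_or_nontrivial V with hV | hV
  · have hE : IsEmpty G.edgeSet := ⟨fun e ↦ by
      induction h : e.1 with | _ a b
      have hab : G.Adj a b := by simpa [h] using e.2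
      exact hab.ne (Subsingleton.elim a b)⟩
    have h0 : G.edgeFinset.card = 0 := by rw [edgeFinset_card, Fintype.card_eq_zero]
    refine ⟨(Fintype.equivFinOfCardEq (by rw [← edgeFinset_card])).trans (pathEdgeEquiv _),
      fun P Q hPQ ↦ (hPQ (Subsingleton.elim P Q)).elim, fun e ↦ (hE.false e).elim⟩
  obtain ⟨C, hC⟩ := hC
  obtain ⟨M, hM, hdegM⟩ := hT.degree_eq_one_iff_dist_eq hC
  obtain ⟨par, hpar⟩ := hT.connected.exists_parent C
  have hd := fun v hv ↦ (hpar v hv).2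
  obtain ⟨K, hinj, hlt, hrev⟩ := exists_alternating_key (G.dist C) par
  let β := Equiv.ofBijective _ (parentEdge_bijective hT hpar)
  obtain ⟨r, hr⟩ := exists_equiv_fin_lt_iff (hinj.comp Subtype.val_injective)
    (m := G.edgeFinset.card) (by rw [Fintype.card_congr β, edgeFinset_card])
  simp only [Function.comp_apply] at hr
  let φ := β.symm.trans (r.trans (pathEdgeEquiv _))
  have hφ (x) : (φ (β x) : Sym2 _) = pathEdge (r x) := by simp [φ, coe_pathEdgeEquiv]
  have himage (P : V) :
      edgeImage φ (G.incidenceSet P) = pathEdge '' (r '' parentEdgeStar C par P) := by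
    ext e
    rw [Set.image_image]
    constructor
    · rintro ⟨e, he, rfl⟩
      obtain ⟨x, rfl⟩ := β.surjective e
      exact ⟨x, (parentEdge_mem_incidenceSet_iff hpar x P).1 he, (hφ x).symm⟩
    · rintro ⟨x, hx, rfl⟩
      exact ⟨β x, (parentEdge_mem_incidenceSet_iff hpar x P).2 hx, hφ x⟩
  have hcatch {P Q : V} (hPQ : P ≠ Q) (heven : Even (G.dist C P + G.dist C Q)) :
      DoesNotCatch (pathGraph (G.edgeFinset.card + 1)) (edgeImage φ (G.incidenceSet P))
        (edgeImage φ (G.incidenceSet Q)) := by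
    rw [himage, himage]
    refine doesNotCatch_pathGraph
      ((Set.disjoint_image_iff r.injective).2 (disjoint_parentEdgeStar hd hPQ heven)) ?_
    rintro _ ⟨x, hx, rfl⟩ _ ⟨y, hy, rfl⟩ hxy
    rcases star_between_or_not_between hd hinj hlt hrev hPQ heven hx hy ((hr x y).1 hxy) with
      ⟨hyQ, h⟩ | h
    · have hQ : G.degree Q ≠ 1 := by
        rw [Ne, hdegM]
        have := hM y
        omega
      convert hdeg Q hQ
      rw [← card_parentEdgeStar hT hpar, ← Set.ncard_image_of_injective _ r.injective,
        ← Set.ncard_coe_finset]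
      congr 1
      ext k
      simp only [Finset.coe_filter, Finset.mem_univ, true_and, Set.mem_ofPred_eq]
      refine and_iff_left_of_imp ?_
      rintro ⟨z, hz, rfl⟩
      rw [hr, hr]
      exact h z hz
    · refine (congrArg Even (Finset.card_eq_zero.2 (Finset.filter_eq_empty_iff.2 ?_))).mpr .zero
      rintro _ - ⟨⟨z, hz, rfl⟩, hk⟩
      rw [hr, hr] at hk
      exact h z hz hk
  refine ⟨φ, fun P Q hPQ heven ↦ ?_, fun e f he hf ↦ ?_⟩
  · have h : Even (G.dist C P + G.dist C Q) := by
      have := hT.even_dist_add_dist C P Q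
      grind
    exact ⟨hcatch hPQ h, hcatch hPQ.symm (by rwa [add_comm])⟩
  · obtain ⟨x, rfl⟩ := β.surjective e
    obtain ⟨y, rfl⟩ := β.surjective f
    rw [hφ, hφ, sym2Min_pathEdge, sym2Min_pathEdge, Fin.castSucc_lt_castSucc_iff, hr]
    refine hlt _ _ ?_
    have hxM : G.dist C x ≠ M := fun h ↦ he ⟨x, Sym2.mem_mk_left _ _, (hdegM x).2 h⟩
    have hyM : G.dist C y = M := by
      obtain ⟨v, hv, hv1⟩ := hf
      rw [hdegM] at hv1
      rcases Sym2.mem_iff.1 hv with rfl | rfl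
      · exact hv1
      · have := hd y y.2
        have := hM y
        omega
    have := hM x
    omega
end

section
/- Let G be a finite tree, let C be a vertex of G at the same distance ρ from all leaves of G, let Q be a leaf of G, and let P be a vertex adjacent to some leaf of G (possibly a different leaf). Then the distance between P and Q in G is odd. -/
open SimpleGraph

/-- Along a walk in a tree, the distance to a fixed vertex changes parity at every step. -/
theorem SimpleGraph.IsTree.even_dist_add_dist_add_length {V : Type*} {G : SimpleGraph V}
    (hT : G.IsTree) (u : V) {v w : V} (p : G.Walk v w) :
    Even (G.dist u v + G.dist u w + p.length) := by
  induction p with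
  | nil => simp
  | cons h p ih =>
    have h' := hT.dist_eq_dist_add_one_of_adj u h
    rw [Walk.length_cons]
    grind

/-- **Lemma (oddness).** In a finite tree `G` with a vertex `C` at the same distance `ρ`
from all leaves, the distance from a vertex `P` adjacent to some leaf to any leaf `Q`
is odd. -/
theorem dist_to_leaf_odd {V : Type*} [Fintype V] [DecidableEq V]
    (G : SimpleGraph V) [DecidableRel G.Adj] (hT : G.IsTree)
    (C : V) (ρ : ℕ) (hC : ∀ x : V, G.degree x = 1 → G.dist C x = ρ)
    (Q : V) (hQ : G.degree Q = 1)
    (P : V) (hP : ∃ L : V, G.degree L = 1 ∧ G.Adj P L) :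
    Odd (G.dist P Q) := by
  obtain ⟨L, hL, hPL⟩ := hP
  obtain ⟨p, hp⟩ := hT.connected.exists_walk_length_eq_dist P Q
  have hpar := hT.even_dist_add_dist_add_length C p
  have hadj := hT.dist_eq_dist_add_one_of_adj C hPL
  rw [hC L hL] at hadj
  rw [hC Q hQ, hp] at hpar
  grind
end

section
/- Friendliness of trees is symmetric: if G₁ and G₂ are finite trees and φ: E(G₁) → E(G₂) is a friendly bijection, then the inverse bijection φ⁻¹: E(G₂) → E(G₁) is friendly; in particular, if G₁ is friendly to G₂ then G₂ is friendly to G₁. -/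
open SimpleGraph

section LinearAlgebra

variable {R M : Type*} [Ring R] [AddCommGroup M] [Module R M]

/-- If `A` and `B` are projections along the pairs `(L₀, L₁)` and `(N₀, N₁)` modulo the common
intersection, and `B` preserves `L₀` and `L₁`, then `A` preserves `N₀` and `N₁`. -/
theorem mapsTo_of_mapsTo_of_inf_eq {L₀ L₁ N₀ N₁ : Submodule R M} {A B : M →ₗ[R] M}
    (hA₀ : ∀ v, A v ∈ L₀) (hA₁ : ∀ v, v - A v ∈ L₁)
    (hB₀ : ∀ v, B v ∈ N₀) (hB₁ : ∀ v, v - B v ∈ N₁) (hLN : L₀ ⊓ L₁ = N₀ ⊓ N₁)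
    (h₀ : ∀ v ∈ L₀, B v ∈ L₀) (h₁ : ∀ v ∈ L₁, B v ∈ L₁) :
    (∀ v ∈ N₀, A v ∈ N₀) ∧ ∀ v ∈ N₁, A v ∈ N₁ := by
  have hsplit (v : M) : B v = B (A v) + B (v - A v) := by rw [← map_add, add_sub_cancel]
  have hBA₀ (v : M) : B (A v) ∈ L₀ := h₀ _ (hA₀ v)
  have hBA₁ (v : M) : B (v - A v) ∈ L₁ := h₁ _ (hA₁ v)
  refine ⟨fun v hv ↦ ?_, fun v hv ↦ ?_⟩
  · have hc : v - B v ∈ L₀ ⊓ L₁ := hLN ▸ ⟨sub_mem hv (hB₀ v), hB₁ v⟩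
    have hd : A v - B (A v) ∈ L₀ ⊓ L₁ := by
      refine ⟨sub_mem (hA₀ v) (hBA₀ v), ?_⟩
      have : A v - B (A v) = (v - B v) - ((v - A v) - B (v - A v)) := by
        rw [hsplit v]; abel
      rw [this]
      exact sub_mem hc.2 (sub_mem (hA₁ v) (hBA₁ v))
    rw [hLN] at hd
    simpa using add_mem hd.1 (hB₀ (A v))
  · have hc : B v ∈ L₀ ⊓ L₁ := by
      rw [hLN]
      exact ⟨hB₀ v, by simpa using sub_mem hv (hB₁ v)⟩
    have hd : B (A v) ∈ L₀ ⊓ L₁ := by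
      refine ⟨hBA₀ v, ?_⟩
      rw [eq_sub_of_add_eq (hsplit v).symm]
      exact sub_mem hc.2 (hBA₁ v)
    rw [hLN] at hd
    simpa using add_mem (hB₁ (A v)) hd.2

end LinearAlgebra

namespace SimpleGraph

variable {V : Type*} {G : SimpleGraph V}

/-- A function on vertices with prescribed sums mod 2 along edges integrates along walks. -/
theorem Walk.sum_edges_eq_add {F : V → ZMod 2} {h : Sym2 V → ZMod 2}
    (hF : ∀ x y, G.Adj x y → F x + F y = h s(x, y)) {u v : V} (w : G.Walk u v) :
    (w.edges.map h).sum = F u + F v := by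
  induction w with
  | nil => simp [CharTwo.add_self_eq_zero]
  | @cons x y z hadj w ih =>
    rw [Walk.edges_cons, List.map_cons, List.sum_cons, ih, ← hF _ _ hadj]
    linear_combination CharTwo.add_self_eq_zero (F y)

/-- Between any two edges of a connected graph there is a path that contains
neither of them. -/
theorem Connected.exists_isPath_between_edges (hG : G.Connected) {e f : Sym2 V} :
    ∃ (u v : V) (w : G.Walk u v), w.IsPath ∧ u ∈ e ∧ v ∈ f ∧ e ∉ w.edges ∧ f ∉ w.edges := by
  classical
  have hex : ∃ n, ∃ u ∈ e, ∃ v ∈ f, ∃ w : G.Walk u v, w.length = n :=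
    ⟨_, _, e.out_fst_mem, _, f.out_fst_mem, (hG _ _).some, rfl⟩
  obtain ⟨u, hu, v, hv, w, hw⟩ := Nat.find_spec hex
  have hmin {u' v' : V} (hu' : u' ∈ e) (hv' : v' ∈ f) (w' : G.Walk u' v') :
      w.length ≤ w'.length :=
    hw ▸ Nat.find_min' hex ⟨u', hu', v', hv', w', rfl⟩
  have hpath : w.IsPath :=
    w.isPath_of_length_eq_dist <| le_antisymm
      (by obtain ⟨w', hw'⟩ := hG.exists_walk_length_eq_dist u v
          exact hw' ▸ hmin hu hv w') (dist_le w)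
  have hstart {x : V} (hx : x ∈ w.support) (hxe : x ∈ e) : x = u := by
    by_contra hne
    exact (hmin hxe hv (w.dropUntil x hx)).not_gt (w.length_dropUntil_lt_length hx hne)
  have hend {x : V} (hx : x ∈ w.support) (hxf : x ∈ f) : x = v := by
    by_contra hne
    exact (hmin hu hxf (w.takeUntil x hx)).not_gt (w.length_takeUntil_lt_length hx hne)
  refine ⟨u, v, w, hpath, hu, hv, fun he ↦ ?_, fun hf ↦ ?_⟩
  · induction e with | _ x y
    have hx := hstart (w.fst_mem_support_of_mem_edges he) (by simp)
    have hy := hstart (w.snd_mem_support_of_mem_edges he) (by simp)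
    exact (w.adj_of_mem_edges he).ne (hx.trans hy.symm)
  · induction f with | _ x y
    have hx := hend (w.fst_mem_support_of_mem_edges hf) (by simp)
    have hy := hend (w.snd_mem_support_of_mem_edges hf) (by simp)
    exact (w.adj_of_mem_edges hf).ne (hx.trans hy.symm)

namespace IsTree

/-- The function on the vertices of a tree obtained by summing a function on the edges along
the path from a root. -/
noncomputable def potential (hG : G.IsTree) : (Sym2 V → ZMod 2) →ₗ[ZMod 2] (V → ZMod 2) where
  toFun h x := ((hG.existsUnique_path hG.1.nonempty.some x).choose.edges.map h).sum
  map_add' h h' := by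
    ext x
    exact List.sum_map_add
  map_smul' c h := by
    ext x
    exact List.sum_map_mul_left _ _ _

theorem potential_add_of_adj (hG : G.IsTree) (h : Sym2 V → ZMod 2) {x y : V} (hxy : G.Adj x y) :
    hG.potential h x + hG.potential h y = h s(x, y) := by
  set r := hG.1.nonempty.some
  have hp (z : V) : (hG.existsUnique_path r z).choose.IsPath :=
    (hG.existsUnique_path r z).choose_spec.1
  change ((hG.existsUnique_path r x).choose.edges.map h).sum +
    ((hG.existsUnique_path r y).choose.edges.map h).sum = _
  by_cases hx : x ∈ (hG.existsUnique_path r y).choose.support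
  · rw [hG.isAcyclic.path_concat (hp x) (hp y) hxy hx]
    simp [Walk.edges_concat, ← add_assoc, CharTwo.add_self_eq_zero]
  · have hy := hG.isAcyclic.mem_support_of_ne_mem_support_of_adj_of_isPath (hp x) (hp y) hxy hx
    rw [hG.isAcyclic.path_concat (hp y) (hp x) hxy.symm hy]
    simp only [Walk.edges_concat, List.map_append, List.sum_append, List.concat_eq_append,
      List.map_cons, List.map_nil, List.sum_singleton, Sym2.eq_swap (a := y)]
    rw [add_right_comm, CharTwo.add_self_eq_zero, zero_add]

theorem potential_eq_of_mem (hG : G.IsTree) {h : Sym2 V → ZMod 2} {e : Sym2 V}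
    (he : e ∈ G.edgeSet) (h0 : h e = 0) {x y : V} (hx : x ∈ e) (hy : y ∈ e) :
    hG.potential h x = hG.potential h y := by
  by_cases hxy : x = y
  · rw [hxy]
  · obtain rfl := (Sym2.mem_and_mem_iff hxy).1 ⟨hx, hy⟩
    rw [← CharTwo.add_eq_zero, hG.potential_add_of_adj h he, h0]

/-- The bipartition of a tree. -/
noncomputable def colour (hG : G.IsTree) : V → ZMod 2 := hG.potential 1

theorem colour_add_of_adj (hG : G.IsTree) {x y : V} (hxy : G.Adj x y) :
    hG.colour x + hG.colour y = 1 :=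
  hG.potential_add_of_adj 1 hxy

theorem even_dist_iff (hG : G.IsTree) (x y : V) :
    Even (G.dist x y) ↔ hG.colour x = hG.colour y := by
  obtain ⟨w, hw⟩ := hG.1.exists_walk_length_eq_dist x y
  have := w.sum_edges_eq_add (F := hG.colour) (h := 1) fun _ _ ↦ hG.colour_add_of_adj
  rw [← hw, ← ZMod.natCast_eq_zero_iff_even, ← CharTwo.add_eq_zero (a := hG.colour x), ← this]
  simp [Pi.one_def]

theorem exists_mem_colour_eq (hG : G.IsTree) (e : G.edgeSet) (c : ZMod 2) :
    ∃ x ∈ (e : Sym2 V), hG.colour x = c := by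
  obtain ⟨e, he⟩ := e
  induction e with | _ x y
  have := hG.colour_add_of_adj he
  generalize hX : hG.colour x = X at this
  generalize hY : hG.colour y = Y at this
  have hXY : X = c ∨ Y = c := by
    clear hX hY he
    revert X Y c
    decide
  rcases hXY with h | h
  · exact ⟨x, by simp, hX.trans h⟩
  · exact ⟨y, by simp, hY.trans h⟩

theorem eq_of_mem_of_colour_eq (hG : G.IsTree) {e : Sym2 V} (he : e ∈ G.edgeSet) {x y : V}
    (hx : x ∈ e) (hy : y ∈ e) (hxy : hG.colour x = hG.colour y) : x = y := by
  by_contra hne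
  obtain rfl := (Sym2.mem_and_mem_iff hne).1 ⟨hx, hy⟩
  have := hG.colour_add_of_adj he
  rw [hxy, CharTwo.add_self_eq_zero] at this
  exact zero_ne_one this

theorem doesNotCatch_iff (hG : G.IsTree) {p q : Set (Sym2 V)} (hp : p ⊆ G.edgeSet) :
    DoesNotCatch G p q ↔ p ∩ q = ∅ ∧ ∀ e ∈ p, ∀ f ∈ p, ∀ x ∈ e, ∀ y ∈ f,
      hG.potential (q.indicator 1) x = hG.potential (q.indicator 1) y := by
  classical
  refine and_congr_right fun hpq ↦ ?_
  have h0 {e : Sym2 V} (he : e ∈ p) : q.indicator (1 : Sym2 V → ZMod 2) e = 0 :=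
    Set.indicator_of_notMem (fun h ↦ (Set.eq_empty_iff_forall_notMem.1 hpq e) ⟨he, h⟩) _
  have hwalk {u v : V} (w : G.Walk u v) :
      Even (w.edges.countP (fun x => @decide (x ∈ q) (Classical.propDecidable _))) ↔
        hG.potential (q.indicator 1) u = hG.potential (q.indicator 1) v := by
    rw [← CharTwo.add_eq_zero, ← w.sum_edges_eq_add fun _ _ ↦ hG.potential_add_of_adj _,
      ← ZMod.natCast_eq_zero_iff_even]
    suffices ∀ l : List (Sym2 V),
        ((l.countP (fun x => @decide (x ∈ q) (Classical.propDecidable _)) : ℕ) : ZMod 2) =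
          (l.map (q.indicator 1)).sum by rw [this]
    intro l
    induction l with
    | nil => simp
    | cons a l ih =>
      by_cases ha : a ∈ q <;> simp [ih, ha, add_comm]
  constructor
  · intro h e he f hf x hx y hy
    by_cases hef : e = f
    · exact hG.potential_eq_of_mem (hp he) (h0 he) hx (hef ▸ hy)
    · obtain ⟨u, v, w, hw, hu, hv, hew, hfw⟩ := hG.1.exists_isPath_between_edges (e := e) (f := f)
      rw [hG.potential_eq_of_mem (hp he) (h0 he) hx hu,
        (hwalk w).1 (h e he f hf hef u v w hw hu hv hew hfw),
        hG.potential_eq_of_mem (hp hf) (h0 hf) hv hy]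
  · intro h e he f hf _ u v w _ hu hv _ _
    exact (hwalk w).2 (h e he f hf u hu v hv)

section EdgeFunctions

variable {E : Type*}

/-- The functions on edges that are constant on the star of every vertex of colour `c`. -/
def starConstant (hG : G.IsTree) (ι : E ≃ G.edgeSet) (c : ZMod 2) :
    Submodule (ZMod 2) (E → ZMod 2) where
  carrier := {v | ∀ P, hG.colour P = c →
    ∀ e f, P ∈ (ι e : Sym2 V) → P ∈ (ι f : Sym2 V) → v e = v f}
  add_mem' ha hb P hP e f he hf := congrArg₂ (· + ·) (ha P hP e f he hf) (hb P hP e f he hf)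
  zero_mem' _ _ _ _ _ _ := rfl
  smul_mem' c _ ha P hP e f he hf := congrArg (c * ·) (ha P hP e f he hf)

theorem mem_starConstant_inf_iff (hG : G.IsTree) (ι : E ≃ G.edgeSet) {v : E → ZMod 2} :
    v ∈ hG.starConstant ι 0 ⊓ hG.starConstant ι 1 ↔ ∀ e f, v e = v f := by
  refine ⟨fun ⟨h0, h1⟩ ↦ ?_, fun h ↦ ⟨fun _ _ e f _ _ ↦ h e f, fun _ _ e f _ _ ↦ h e f⟩⟩
  have hstar (P : V) (e f : E) (he : P ∈ (ι e : Sym2 V)) (hf : P ∈ (ι f : Sym2 V)) :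
      v e = v f := by
    have hc : ∀ c : ZMod 2, c = 0 ∨ c = 1 := by decide
    exact (hc (hG.colour P)).elim (fun h ↦ h0 P h e f he hf) (fun h ↦ h1 P h e f he hf)
  have hwalk {x y : V} (w : G.Walk x y) :
      ∀ e f, x ∈ (ι e : Sym2 V) → y ∈ (ι f : Sym2 V) → v e = v f := by
    induction w with
    | nil => exact hstar _
    | @cons x z y hadj w ih =>
      intro e f he hf
      have hg : (ι (ι.symm ⟨s(x, z), hadj⟩) : Sym2 V) = s(x, z) := by simp
      exact (hstar x e _ he (by rw [hg]; exact Sym2.mem_mk_left x z)).trans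
        (ih _ f (by rw [hg]; exact Sym2.mem_mk_right x z) hf)
  exact fun e f ↦ hwalk (hG.1 _ _).some e f (ι e).1.out_fst_mem (ι f).1.out_fst_mem

/-- Extension by zero of a function on edges to all unordered pairs. -/
noncomputable def extendEdges (ι : E ≃ G.edgeSet) :
    (E → ZMod 2) →ₗ[ZMod 2] (Sym2 V → ZMod 2) :=
  Function.ExtendByZero.linearMap (ZMod 2) fun e ↦ (ι e : Sym2 V)

theorem extendEdges_apply (ι : E ≃ G.edgeSet) (v : E → ZMod 2) (e : E) :
    extendEdges ι v (ι e) = v e :=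
  (Subtype.val_injective.comp ι.injective).extend_apply v 0 e

theorem extendEdges_indicator (ι : E ≃ G.edgeSet) (s : Set E) :
    extendEdges ι (s.indicator 1) = ((fun e ↦ (ι e : Sym2 V)) '' s).indicator 1 := by
  ext e
  by_cases he : e ∈ G.edgeSet
  · obtain ⟨e, rfl⟩ : ∃ e', (ι e' : Sym2 V) = e := ⟨ι.symm ⟨e, he⟩, by simp⟩
    rw [extendEdges_apply]
    by_cases hs : e ∈ s
    · rw [Set.indicator_of_mem hs, Set.indicator_of_mem (Set.mem_image_of_mem _ hs),
        Pi.one_apply, Pi.one_apply]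
    · rw [Set.indicator_of_notMem hs, Set.indicator_of_notMem]
      rintro ⟨f, hf, hfe⟩
      exact hs ((Subtype.val_injective.comp ι.injective) hfe ▸ hf)
  · rw [Set.indicator_of_notMem]
    · exact Function.extend_apply' _ _ _ fun ⟨f, hf⟩ ↦ he (hf ▸ (ι f).2)
    · rintro ⟨f, -, rfl⟩
      exact he (ι f).2

/-- The endpoint of colour `0` of an edge of a tree. -/
noncomputable def whiteEnd (hG : G.IsTree) (e : G.edgeSet) : V :=
  (hG.exists_mem_colour_eq e 0).choose

theorem whiteEnd_mem (hG : G.IsTree) (e : G.edgeSet) : hG.whiteEnd e ∈ (e : Sym2 V) :=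
  (hG.exists_mem_colour_eq e 0).choose_spec.1

theorem colour_whiteEnd (hG : G.IsTree) (e : G.edgeSet) : hG.colour (hG.whiteEnd e) = 0 :=
  (hG.exists_mem_colour_eq e 0).choose_spec.2

/-- The potential of a function on edges, evaluated at the endpoints of colour `0`. Modulo
constants, this is the projection onto `starConstant 0` along `starConstant 1`. -/
noncomputable def edgeProj (hG : G.IsTree) (ι : E ≃ G.edgeSet) :
    (E → ZMod 2) →ₗ[ZMod 2] (E → ZMod 2) :=
  LinearMap.funLeft (ZMod 2) (ZMod 2) (fun e ↦ hG.whiteEnd (ι e)) ∘ₗ hG.potential ∘ₗ extendEdges ι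

theorem edgeProj_apply (hG : G.IsTree) (ι : E ≃ G.edgeSet) (v : E → ZMod 2) (e : E) :
    hG.edgeProj ι v e = hG.potential (extendEdges ι v) (hG.whiteEnd (ι e)) :=
  rfl

theorem edgeProj_mem (hG : G.IsTree) (ι : E ≃ G.edgeSet) (v : E → ZMod 2) :
    hG.edgeProj ι v ∈ hG.starConstant ι 0 := by
  intro P hP e f he hf
  rw [edgeProj_apply, edgeProj_apply,
    hG.eq_of_mem_of_colour_eq (ι e).2 (hG.whiteEnd_mem _) he ((hG.colour_whiteEnd _).trans hP.symm),
    hG.eq_of_mem_of_colour_eq (ι f).2 (hG.whiteEnd_mem _) hf ((hG.colour_whiteEnd _).trans hP.symm)]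

theorem sub_edgeProj_mem (hG : G.IsTree) (ι : E ≃ G.edgeSet) (v : E → ZMod 2) :
    v - hG.edgeProj ι v ∈ hG.starConstant ι 1 := by
  intro P hP
  have key (e : E) (he : P ∈ (ι e : Sym2 V)) :
      (v - hG.edgeProj ι v) e = hG.potential (extendEdges ι v) P := by
    have hne : hG.whiteEnd (ι e) ≠ P := by
      rintro rfl
      rw [hG.colour_whiteEnd] at hP
      exact zero_ne_one hP
    have hs := (Sym2.mem_and_mem_iff hne).1 ⟨hG.whiteEnd_mem _, he⟩
    have hadj : G.Adj (hG.whiteEnd (ι e)) P := by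
      rw [← mem_edgeSet, ← hs]
      exact (ι e).2
    have := hG.potential_add_of_adj (extendEdges ι v) hadj
    rw [← hs, extendEdges_apply] at this
    rw [Pi.sub_apply, edgeProj_apply, ← this, add_sub_cancel_left]
  exact fun e f he hf ↦ (key e he).trans (key f hf).symm

theorem edgeProj_one (hG : G.IsTree) (ι : E ≃ G.edgeSet) (e f : E) :
    hG.edgeProj ι 1 e = hG.edgeProj ι 1 f := by
  refine (hG.mem_starConstant_inf_iff ι).1 ⟨hG.edgeProj_mem ι 1, ?_⟩ e f
  have h1 := ((hG.mem_starConstant_inf_iff ι (v := 1)).2 fun _ _ ↦ rfl).2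
  simpa using sub_mem h1 (hG.sub_edgeProj_mem ι 1)

/-- Functions constant on stars of colour `c` are combinations of indicators of such stars. -/
theorem exists_eq_sum_of_mem_starConstant [Fintype V] (hG : G.IsTree) (ι : E ≃ G.edgeSet)
    {c : ZMod 2} {v : E → ZMod 2} (hv : v ∈ hG.starConstant ι c) :
    ∃ a : V → ZMod 2, v = ∑ Q with hG.colour Q = c,
      a Q • {e | Q ∈ (ι e : Sym2 V)}.indicator (1 : E → ZMod 2) := by
  have hex (Q : V) : ∃ a, hG.colour Q = c → ∀ e, Q ∈ (ι e : Sym2 V) → v e = a := by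
    by_cases h : ∃ e, Q ∈ (ι e : Sym2 V)
    · obtain ⟨f, hf⟩ := h
      exact ⟨v f, fun hQ e he ↦ hv Q hQ e f he hf⟩
    · exact ⟨0, fun _ e he ↦ (h ⟨e, he⟩).elim⟩
  choose a ha using hex
  refine ⟨a, funext fun e ↦ ?_⟩
  obtain ⟨Q, hQe, hQ⟩ := hG.exists_mem_colour_eq (ι e) c
  rw [Finset.sum_apply, Finset.sum_eq_single Q]
  · simp [hQe, ha Q hQ e hQe]
  · intro P hP hPQ
    have hPe : P ∉ (ι e : Sym2 V) := fun h ↦ hPQ <|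
      hG.eq_of_mem_of_colour_eq (ι e).2 h hQe ((Finset.mem_filter.1 hP).2.trans hQ.symm)
    simp [hPe]
  · simp [hQ]

end EdgeFunctions

end IsTree

end SimpleGraph

section Friendly

variable {V₁ V₂ E : Type*} {G₁ : SimpleGraph V₁} {G₂ : SimpleGraph V₂}

theorem edgeImage_incidenceSet (ι₁ : E ≃ G₁.edgeSet) (ι₂ : E ≃ G₂.edgeSet) (P : V₁) :
    edgeImage (ι₁.symm.trans ι₂) (G₁.incidenceSet P) =
      (fun e ↦ (ι₂ e : Sym2 V₂)) '' {e | P ∈ (ι₁ e : Sym2 V₁)} := by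
  ext f
  constructor
  · rintro ⟨e, he, rfl⟩
    exact ⟨ι₁.symm e, by simpa using he.2, rfl⟩
  · rintro ⟨e, he, rfl⟩
    exact ⟨ι₁ e, ⟨(ι₁ e).2, he⟩, by simp⟩

/-- A vertex star does not catch another star of the same colour if and only if the projection
of the indicator of the latter is constant on the former. -/
theorem doesNotCatch_edgeImage_iff (h₁ : G₁.IsTree) (h₂ : G₂.IsTree)
    (ι₁ : E ≃ G₁.edgeSet) (ι₂ : E ≃ G₂.edgeSet) {P Q : V₁} (hPQ : P ≠ Q)
    (hcol : h₁.colour P = h₁.colour Q) :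
    DoesNotCatch G₂ (edgeImage (ι₁.symm.trans ι₂) (G₁.incidenceSet P))
        (edgeImage (ι₁.symm.trans ι₂) (G₁.incidenceSet Q)) ↔
      ∀ e f, P ∈ (ι₁ e : Sym2 V₁) → P ∈ (ι₁ f : Sym2 V₁) →
        h₂.edgeProj ι₂ ({e | Q ∈ (ι₁ e : Sym2 V₁)}.indicator 1) e =
          h₂.edgeProj ι₂ ({e | Q ∈ (ι₁ e : Sym2 V₁)}.indicator 1) f := by
  have hdisj (e : E) (hP : P ∈ (ι₁ e : Sym2 V₁)) : Q ∉ (ι₁ e : Sym2 V₁) :=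
    fun hQ ↦ hPQ (h₁.eq_of_mem_of_colour_eq (ι₁ e).2 hP hQ hcol)
  simp only [edgeImage_incidenceSet]
  rw [h₂.doesNotCatch_iff (by rintro _ ⟨e, -, rfl⟩; exact (ι₂ e).2),
    ← SimpleGraph.IsTree.extendEdges_indicator]
  constructor
  · rintro ⟨-, h⟩ e f he hf
    exact h _ ⟨e, he, rfl⟩ _ ⟨f, hf, rfl⟩ _ (h₂.whiteEnd_mem _) _ (h₂.whiteEnd_mem _)
  · intro h
    refine ⟨?_, ?_⟩
    · rw [Set.eq_empty_iff_forall_notMem]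
      rintro _ ⟨⟨e, he, rfl⟩, ⟨f, hf, hfe⟩⟩
      obtain rfl := (Subtype.val_injective.comp ι₂.injective) hfe
      exact hdisj f he hf
    · have hend (e : E) (he : P ∈ (ι₁ e : Sym2 V₁)) (x : V₂) (hx : x ∈ (ι₂ e : Sym2 V₂)) :
          h₂.potential (SimpleGraph.IsTree.extendEdges ι₂
            ({e | Q ∈ (ι₁ e : Sym2 V₁)}.indicator 1)) x =
          h₂.edgeProj ι₂ ({e | Q ∈ (ι₁ e : Sym2 V₁)}.indicator 1) e := by
        refine h₂.potential_eq_of_mem (ι₂ e).2 ?_ hx (h₂.whiteEnd_mem _)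
        rw [SimpleGraph.IsTree.extendEdges_apply]
        exact Set.indicator_of_notMem (s := {e | Q ∈ (ι₁ e : Sym2 V₁)}) (hdisj e he) _
      rintro _ ⟨e, he, rfl⟩ _ ⟨f, hf, rfl⟩ x hx y hy
      rw [hend e he x hx, hend f hf y hy, h e f he hf]

/-- A bijection is friendly if and only if the projection of the second tree preserves the
spaces of functions constant on stars of either colour of the first tree. -/
theorem friendlyBij_iff [Fintype V₁] (h₁ : G₁.IsTree) (h₂ : G₂.IsTree)
    (ι₁ : E ≃ G₁.edgeSet) (ι₂ : E ≃ G₂.edgeSet) :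
    FriendlyBij G₁ G₂ (ι₁.symm.trans ι₂) ↔
      ∀ c, ∀ v ∈ h₁.starConstant ι₁ c, h₂.edgeProj ι₂ v ∈ h₁.starConstant ι₁ c := by
  classical
  let S (Q : V₁) : E → ZMod 2 := {e | Q ∈ (ι₁ e : Sym2 V₁)}.indicator 1
  constructor
  · intro h c v hv
    have hother {P Q : V₁} (hPQ : P ≠ Q) (hcol : h₁.colour P = h₁.colour Q) (e f : E)
        (he : P ∈ (ι₁ e : Sym2 V₁)) (hf : P ∈ (ι₁ f : Sym2 V₁)) :
        h₂.edgeProj ι₂ (S Q) e = h₂.edgeProj ι₂ (S Q) f :=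
      (doesNotCatch_edgeImage_iff h₁ h₂ ι₁ ι₂ hPQ hcol).1
        (h P Q hPQ ((h₁.even_dist_iff P Q).2 hcol)).1 e f he hf
    have hone : ∑ Q with h₁.colour Q = c, S Q = 1 := by
      ext e
      obtain ⟨Q, hQe, hQ⟩ := h₁.exists_mem_colour_eq (ι₁ e) c
      rw [Finset.sum_apply, Finset.sum_eq_single Q]
      · simp [S, hQe]
      · intro P hP hPQ
        have hPe : P ∉ (ι₁ e : Sym2 V₁) := fun h ↦ hPQ <|
          h₁.eq_of_mem_of_colour_eq (ι₁ e).2 h hQe ((Finset.mem_filter.1 hP).2.trans hQ.symm)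
        simp [S, hPe]
      · simp [hQ]
    have hS (Q : V₁) (hQ : h₁.colour Q = c) :
        h₂.edgeProj ι₂ (S Q) ∈ h₁.starConstant ι₁ c := by
      intro P hP e f he hf
      by_cases hPQ : P = Q
      · subst hPQ
        have hsum : S P = 1 - ∑ Q ∈ ({Q | h₁.colour Q = c} : Finset V₁).erase P, S Q := by
          rw [← hone, ← Finset.add_sum_erase _ _ (by simpa using hP : P ∈ _), add_sub_cancel_right]
        rw [hsum, map_sub, map_sum, Pi.sub_apply, Pi.sub_apply, h₂.edgeProj_one ι₂ e f,
          Finset.sum_apply, Finset.sum_apply]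
        refine congrArg _ (Finset.sum_congr rfl fun Q hQ' ↦ ?_)
        obtain ⟨hne, hQ'⟩ := Finset.mem_erase.1 hQ'
        exact hother hne.symm (hP.trans (Finset.mem_filter.1 hQ').2.symm) e f he hf
      · exact hother hPQ (hP.trans hQ.symm) e f he hf
    obtain ⟨a, rfl⟩ := h₁.exists_eq_sum_of_mem_starConstant ι₁ hv
    rw [map_sum]
    refine sum_mem fun Q hQ ↦ ?_
    rw [map_smul]
    exact Submodule.smul_mem _ _ (hS Q (Finset.mem_filter.1 hQ).2)
  · intro h P Q hPQ hdist
    have hcol := (h₁.even_dist_iff P Q).1 hdist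
    have hS (Q : V₁) : S Q ∈ h₁.starConstant ι₁ (h₁.colour Q) := by
      intro P hP e f he hf
      have hmem {g : E} (hg : P ∈ (ι₁ g : Sym2 V₁)) : Q ∈ (ι₁ g : Sym2 V₁) ↔ P = Q :=
        ⟨fun hQ ↦ h₁.eq_of_mem_of_colour_eq (ι₁ g).2 hg hQ hP, fun h ↦ h ▸ hg⟩
      simp [S, Set.indicator_apply, hmem he, hmem hf]
    exact ⟨(doesNotCatch_edgeImage_iff h₁ h₂ ι₁ ι₂ hPQ hcol).2 (h _ _ (hS Q) P hcol),
      (doesNotCatch_edgeImage_iff h₁ h₂ ι₁ ι₂ hPQ.symm hcol.symm).2 (h _ _ (hS P) Q hcol.symm)⟩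

theorem FriendlyBij.symm [Fintype V₁] [Fintype V₂] (h₁ : G₁.IsTree) (h₂ : G₂.IsTree)
    {φ : G₁.edgeSet ≃ G₂.edgeSet} (h : FriendlyBij G₁ G₂ φ) : FriendlyBij G₂ G₁ φ.symm := by
  have hφ := (friendlyBij_iff h₁ h₂ (Equiv.refl _) φ).1 h
  refine (friendlyBij_iff h₂ h₁ φ (Equiv.refl _)).2 ?_
  have hinf : h₁.starConstant (Equiv.refl _) 0 ⊓ h₁.starConstant (Equiv.refl _) 1 =
      h₂.starConstant φ 0 ⊓ h₂.starConstant φ 1 := by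
    ext v
    rw [h₁.mem_starConstant_inf_iff, h₂.mem_starConstant_inf_iff]
  have := mapsTo_of_mapsTo_of_inf_eq (h₁.edgeProj_mem _) (h₁.sub_edgeProj_mem _)
    (h₂.edgeProj_mem φ) (h₂.sub_edgeProj_mem φ) hinf (hφ 0) (hφ 1)
  intro c
  fin_cases c
  exacts [this.1, this.2]

end Friendly

/-- **Statement (symmetry of friendliness).** The inverse of a friendly bijection between
the edge sets of two finite trees is friendly; in particular, friendliness of trees is a
symmetric relation. -/
theorem friendly_symm {V₁ V₂ : Type*} [Fintype V₁] [Fintype V₂]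
    (G₁ : SimpleGraph V₁) (G₂ : SimpleGraph V₂) (h₁ : G₁.IsTree) (h₂ : G₂.IsTree) :
    (∀ φ : G₁.edgeSet ≃ G₂.edgeSet, FriendlyBij G₁ G₂ φ → FriendlyBij G₂ G₁ φ.symm) ∧
    (Friendly G₁ G₂ → Friendly G₂ G₁) := by
  have hsymm (φ : G₁.edgeSet ≃ G₂.edgeSet) (h : FriendlyBij G₁ G₂ φ) :
      FriendlyBij G₂ G₁ φ.symm := h.symm h₁ h₂
  exact ⟨hsymm, fun ⟨φ, h⟩ ↦ ⟨φ.symm, hsymm φ h⟩⟩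
end
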